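/- arXiv:1103.2498 — 2 statements merged into one kernel-verified Lean document; each statement's English description precedes it below -/
import Mathlib

section
/- Assume (H1)-(H3) and (J1)-(J2), let τ≥0, β>0, and suppose ∫_ℝ J₁(y)e^{−λy}dy<∞ for all λ>0. Then there exists a minimal (critical) wave speed c*>0, determined together with λ*>0 by the tangency conditions H_{c*}(λ*)=G_{c*}(λ*) and H'_{c*}(λ*)=G'_{c*}(λ*), such that: (i) for every c≥c* there exists a monotone traveling wavefront φ with speed c connecting u₋=0 and u₊; and (ii) for every c<c* no traveling wavefront with speed c connecting u₋ and u₊ exists. -/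
open MeasureTheory Real Set Filter Asymptotics

noncomputable section

abbrev Rn (n : ℕ) := EuclideanSpace ℝ (Fin n)

/-- The delayed exponential function `e_τ^{kt}`: it equals `0` for `t < -τ`,
and `∑_{j=0}^{m} k^j (t-(j-1)τ)^j / j!` for `(m-1)τ ≤ t < mτ` (where for
`t ≥ -τ` one has `m = ⌊t/τ⌋ + 1`). -/
noncomputable def delayedExp (τ k t : ℝ) : ℝ :=
  if t < -τ then 0
  else ∑ j ∈ Finset.range (⌊t / τ⌋ + 2).toNat,
      k ^ j * (t - ((j : ℝ) - 1) * τ) ^ j / (Nat.factorial j : ℝ)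

/-- Fourier transform of a real kernel on ℝⁿ: `Ĵ(η) = ∫ e^{-i y·η} J(y) dy`. -/
noncomputable def FT {n : ℕ} (J : Rn n → ℝ) (η : Rn n) : ℂ :=
  ∫ y, Complex.exp (-Complex.I * ((inner ℝ y η : ℝ) : ℂ)) * (J y : ℂ)

/-- The n-dimensional heat kernel `f_β(y) = (4πβ)^{-n/2} e^{-|y|²/(4β)}`. -/
noncomputable def heatKernel (n : ℕ) (β : ℝ) (y : Rn n) : ℝ :=
  (4 * Real.pi * β) ^ (-(n : ℝ) / 2) * Real.exp (-‖y‖ ^ 2 / (4 * β))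

/-- The one-dimensional heat kernel `f_{1β}`. -/
noncomputable def heatKernel1 (β : ℝ) (y : ℝ) : ℝ :=
  (4 * Real.pi * β) ^ (-(1 : ℝ) / 2) * Real.exp (-y ^ 2 / (4 * β))

/-- Partial derivative in the `i`-th coordinate direction. -/
noncomputable def pd {n : ℕ} (i : Fin n) (f : Rn n → ℝ) : Rn n → ℝ :=
  fun x => fderiv ℝ f x (EuclideanSpace.single i 1)

/-- Multi-index partial derivative `∂^j_x`. -/
noncomputable def mpd {n : ℕ} (j : Fin n → ℕ) (f : Rn n → ℝ) : Rn n → ℝ :=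
  ((List.ofFn fun i : Fin n => (pd i)^[j i]).foldr (· ∘ ·) id) f

/-- Square of the (unweighted) Sobolev `H^m` norm:
`∑_{|j| ≤ m} ∫ |∂^j f|²`. -/
noncomputable def HSobSq {n : ℕ} (m : ℕ) (f : Rn n → ℝ) : ℝ :=
  ∑ j ∈ Finset.univ.filter (fun j : Fin n → Fin (m + 1) => (∑ i, (j i : ℕ)) ≤ m),
    ∫ x, (mpd (fun i => (j i : ℕ)) f x) ^ 2

/-- Square of the weighted Sobolev `H^m_w` norm, with a weight depending on the
first coordinate: `∑_{|j| ≤ m} ∫ w(x₁) |∂^j f|²`. -/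
noncomputable def HSobSqW {n : ℕ} [NeZero n] (w : ℝ → ℝ) (m : ℕ) (f : Rn n → ℝ) : ℝ :=
  ∑ j ∈ Finset.univ.filter (fun j : Fin n → Fin (m + 1) => (∑ i, (j i : ℕ)) ≤ m),
    ∫ x, w (x 0) * (mpd (fun i => (j i : ℕ)) f x) ^ 2

/-- The weight function `w(x₁) = e^{-λ*(x₁-x*)}` for `x₁ ≤ x*`, `= 1` for `x₁ > x*`. -/
noncomputable def wgt (lamstar xstar x1 : ℝ) : ℝ :=
  if x1 ≤ xstar then Real.exp (-lamstar * (x1 - xstar)) else 1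



set_option linter.all false


structure NL (d b : ℝ → ℝ) (u D d0 b0 κ : ℝ) : Prop where
  hu : 0 < u
  dz : d 0 = 0
  bz : b 0 = 0
  du : d u = b u
  dc : ContinuousOn d (Icc 0 u)
  bc : ContinuousOn b (Icc 0 u)
  bm : MonotoneOn b (Icc 0 u)
  dm : MonotoneOn d (Icc 0 u)
  Dm : MonotoneOn (fun x => D * x - d x) (Icc 0 u)
  hD : 0 ≤ D
  hd0 : 0 ≤ d0
  hd0D : d0 ≤ D
  hb0 : 0 < b0
  d0le : ∀ x ∈ Icc 0 u, d0 * x ≤ d x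
  b0le : ∀ x ∈ Icc 0 u, b x ≤ b0 * x
  lt : ∀ x ∈ Ioo 0 u, d x < b x
  hκ : 0 < κ
  κle : ∀ x ∈ Icc 0 u, κ * x ≤ b x
  hdd : HasDerivAt d d0 0
  hbd : HasDerivAt b b0 0

def Adm (u : ℝ) (g : ℝ → ℝ) : Prop := Monotone g ∧ ∀ x, g x ∈ Icc 0 u

def cv (μ : Measure ℝ) (g : ℝ → ℝ) (x : ℝ) : ℝ := ∫ y, g (x - y) ∂μ

lemma Adm.int {u : ℝ} {g : ℝ → ℝ} (h : Adm u g) (μ : Measure ℝ) [IsProbabilityMeasure μ] (x : ℝ) :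
    Integrable (fun y => g (x - y)) μ := by
  have hm : Measurable (fun y => g (x - y)) :=
    h.1.measurable.comp (measurable_const.sub measurable_id)
  refine Integrable.of_bound hm.aestronglyMeasurable u (ae_of_all _ fun y => ?_)
  rw [Real.norm_eq_abs, abs_of_nonneg (h.2 _).1]
  exact (h.2 _).2

lemma cv_const (μ : Measure ℝ) [IsProbabilityMeasure μ] (L x : ℝ) : cv μ (fun _ => L) x = L := by
  simp [cv]

lemma Adm.cv {u : ℝ} {g : ℝ → ℝ} (h : Adm u g) (μ : Measure ℝ) [IsProbabilityMeasure μ] :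
    Adm u (cv μ g) := by
  refine ⟨fun x x' hx => integral_mono (h.int μ x) (h.int μ x') fun y => h.1 (by linarith), fun x => ⟨integral_nonneg fun y => (h.2 _).1, ?_⟩⟩
  calc _root_.cv μ g x ≤ ∫ y, u ∂μ := integral_mono (h.int μ x) (integrable_const _) fun y => (h.2 _).2
    _ = u := by simp

lemma cv_mono {u u' : ℝ} {g g' : ℝ → ℝ} (h : Adm u g) (h' : Adm u' g') (hle : ∀ x, g x ≤ g' x)
    (μ : Measure ℝ) [IsProbabilityMeasure μ] (x : ℝ) : cv μ g x ≤ cv μ g' x :=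
  integral_mono (h.int μ x) (h'.int μ x) fun y => hle _

lemma cv_tendsto {ι : Type*} {l : Filter ι} [l.IsCountablyGenerated] {u : ℝ} {g : ι → ℝ → ℝ}
    {g' : ℝ → ℝ} (h : ∀ k, Adm u (g k)) (hl : ∀ x, Tendsto (fun k => g k x) l (nhds (g' x)))
    (μ : Measure ℝ) [IsProbabilityMeasure μ] (x : ℝ) :
    Tendsto (fun k => cv μ (g k) x) l (nhds (cv μ g' x)) := by
  refine tendsto_integral_filter_of_dominated_convergence (fun _ => u)
    (Eventually.of_forall fun k => ((h k).int μ x).1)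
    (Eventually.of_forall fun k => ae_of_all _ fun y => ?_) (integrable_const _)
    (ae_of_all _ fun y => hl _)
  rw [Real.norm_eq_abs, abs_of_nonneg ((h k).2 _).1]
  exact ((h k).2 _).2

lemma Adm.shift {u : ℝ} {g : ℝ → ℝ} (h : Adm u g) (s : ℝ) : Adm u (fun x => g (x + s)) :=
  ⟨fun x y hxy => h.1 (by linarith), fun x => h.2 _⟩

lemma Adm.limit {ι : Type*} {l : Filter ι} [l.NeBot] {u : ℝ} {g : ι → ℝ → ℝ}
    {g' : ℝ → ℝ} (h : ∀ k, Adm u (g k)) (hl : ∀ x, Tendsto (fun k => g k x) l (nhds (g' x))) :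
    Adm u g' :=
  ⟨fun x y hxy => le_of_tendsto_of_tendsto' (hl x) (hl y) fun k => (h k).1 hxy,
   fun x => isClosed_Icc.mem_of_tendsto (hl x) (Eventually.of_forall fun k => (h k).2 x)⟩

section ops
variable {d b : ℝ → ℝ} {u D d0 b0 κ : ℝ}
  (ν γ ρ : Measure ℝ) [IsProbabilityMeasure ν] [IsProbabilityMeasure γ] [IsProbabilityMeasure ρ]
  (r : ℝ)

def Fop (d b : ℝ → ℝ) (D : ℝ) (ν γ : Measure ℝ) (r : ℝ) (g : ℝ → ℝ) (x : ℝ) : ℝ :=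
  cv ν g x + (D * g x - d (g x)) + cv γ (fun z => b (g z)) (x - r)

def Tmap (d b : ℝ → ℝ) (D : ℝ) (ν γ ρ : Measure ℝ) (r : ℝ) (g : ℝ → ℝ) (x : ℝ) : ℝ :=
  (D + 1)⁻¹ * cv ρ (Fop d b D ν γ r g) x

lemma NL.bAdm (H : NL d b u D d0 b0 κ) {g : ℝ → ℝ} (h : Adm u g) : Adm (b u) (fun z => b (g z)) :=
  ⟨fun x y hxy => H.bm (h.2 x) (h.2 y) (h.1 hxy), fun x =>
    ⟨by have := H.bm ⟨le_rfl, H.hu.le⟩ (h.2 x) (h.2 x).1; rwa [H.bz] at this,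
     H.bm (h.2 x) ⟨H.hu.le, le_rfl⟩ (h.2 x).2⟩⟩

lemma NL.dAdm (H : NL d b u D d0 b0 κ) {g : ℝ → ℝ} (h : Adm u g) : Adm (D * u - d u) (fun z => D * g z - d (g z)) :=
  ⟨fun x y hxy => H.Dm (h.2 x) (h.2 y) (h.1 hxy), fun x =>
    ⟨by have := H.Dm ⟨le_rfl, H.hu.le⟩ (h.2 x) (h.2 x).1; simpa [H.dz] using this,
     H.Dm (h.2 x) ⟨H.hu.le, le_rfl⟩ (h.2 x).2⟩⟩

lemma NL.FAdm (H : NL d b u D d0 b0 κ) {g : ℝ → ℝ} (h : Adm u g) : Adm ((D + 1) * u) (Fop d b D ν γ r g) := by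
  have h1 := h.cv ν
  have h2 := H.dAdm h
  have h3 := (H.bAdm h).cv γ
  refine ⟨fun x y hxy => ?_, fun x => ?_⟩
  · have e1 := h1.1 hxy
    have e2 := h2.1 hxy
    have e3 := h3.1 (show x - r ≤ y - r by linarith)
    simp only [Fop] at *
    linarith
  · have e1 := h1.2 x
    have e2 := h2.2 x
    have e3 := h3.2 (x - r)
    have := H.du
    simp only [Fop, mem_Icc] at *
    constructor <;> linarith

lemma NL.Fmono (H : NL d b u D d0 b0 κ) {g g' : ℝ → ℝ} (h : Adm u g) (h' : Adm u g') (hle : ∀ x, g x ≤ g' x) (x : ℝ) :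
    Fop d b D ν γ r g x ≤ Fop d b D ν γ r g' x := by
  have e1 := cv_mono h h' hle ν x
  have e2 := H.Dm (h.2 x) (h'.2 x) (hle x)
  have e3 := cv_mono (H.bAdm h) (H.bAdm h') (fun x => H.bm (h.2 x) (h'.2 x) (hle x)) γ (x - r)
  simp only [Fop] at *
  linarith

lemma NL.Ftendsto (H : NL d b u D d0 b0 κ) {ι : Type*} {l : Filter ι} [l.IsCountablyGenerated] [l.NeBot] {g : ι → ℝ → ℝ}
    {g' : ℝ → ℝ} (h : ∀ k, Adm u (g k)) (hl : ∀ x, Tendsto (fun k => g k x) l (nhds (g' x)))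
    (x : ℝ) : Tendsto (fun k => Fop d b D ν γ r (g k) x) l (nhds (Fop d b D ν γ r g' x)) := by
  have h' := Adm.limit h hl
  have key : ∀ f : ℝ → ℝ, ContinuousOn f (Icc 0 u) → ∀ x,
      Tendsto (fun k => f (g k x)) l (nhds (f (g' x))) := fun f hf x =>
    (hf _ (h'.2 x)).tendsto.comp (tendsto_nhdsWithin_iff.2
      ⟨hl x, Eventually.of_forall fun k => (h k).2 x⟩)
  exact ((cv_tendsto h hl ν x).add (((hl x).const_mul D).sub (key d H.dc x))).add
    (cv_tendsto (fun k => H.bAdm (h k)) (key b H.bc) γ (x - r))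

lemma F_const (L x : ℝ) : Fop d b D ν γ r (fun _ => L) x = L + (D * L - d L) + b L := by
  simp [Fop, cv_const]

lemma F_shift (g : ℝ → ℝ) (s x : ℝ) :
    Fop d b D ν γ r (fun z => g (z + s)) x = Fop d b D ν γ r g (x + s) := by
  simp only [Fop, cv]
  congr 2
  · congr 1; ext y; congr 1; ring
  · ext y; congr 2; ring

lemma NL.TAdm (H : NL d b u D d0 b0 κ) {g : ℝ → ℝ} (h : Adm u g) : Adm u (Tmap d b D ν γ ρ r g) := by
  have h1 := (H.FAdm ν γ r h).cv ρ
  have hp : 0 < D + 1 := by linarith [H.hD]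
  refine ⟨fun x y hxy => mul_le_mul_of_nonneg_left (h1.1 hxy) (by positivity), fun x => ⟨mul_nonneg (by positivity) (h1.2 x).1, ?_⟩⟩
  unfold Tmap
  rw [inv_mul_le_iff₀ hp]
  exact (h1.2 x).2

lemma NL.Tmono (H : NL d b u D d0 b0 κ) {g g' : ℝ → ℝ} (h : Adm u g) (h' : Adm u g') (hle : ∀ x, g x ≤ g' x) (x : ℝ) :
    Tmap d b D ν γ ρ r g x ≤ Tmap d b D ν γ ρ r g' x := by
  have hp : 0 < D + 1 := by linarith [H.hD]
  exact mul_le_mul_of_nonneg_left (cv_mono (H.FAdm ν γ r h) (H.FAdm ν γ r h')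
    (H.Fmono ν γ r h h' hle) ρ x) (by positivity)

lemma NL.Ttendsto (H : NL d b u D d0 b0 κ) {ι : Type*} {l : Filter ι} [l.IsCountablyGenerated] [l.NeBot] {g : ι → ℝ → ℝ}
    {g' : ℝ → ℝ} (h : ∀ k, Adm u (g k)) (hl : ∀ x, Tendsto (fun k => g k x) l (nhds (g' x)))
    (x : ℝ) : Tendsto (fun k => Tmap d b D ν γ ρ r (g k) x) l (nhds (Tmap d b D ν γ ρ r g' x)) :=
  (cv_tendsto (fun k => H.FAdm ν γ r (h k)) (H.Ftendsto ν γ r h hl) ρ x).const_mul _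

lemma T_const (hD : 0 ≤ D) (L x : ℝ) :
    Tmap d b D ν γ ρ r (fun _ => L) x = L + (D + 1)⁻¹ * (b L - d L) := by
  have hp : D + 1 ≠ 0 := by linarith
  have : Fop d b D ν γ r (fun _ => L) = fun _ => L + (D * L - d L) + b L := by
    ext x; exact F_const ν γ r L x
  rw [Tmap, this, cv_const]
  field_simp
  ring

lemma T_shift (g : ℝ → ℝ) (s x : ℝ) :
    Tmap d b D ν γ ρ r (fun z => g (z + s)) x = Tmap d b D ν γ ρ r g (x + s) := by
  have : Fop d b D ν γ r (fun z => g (z + s)) = fun x => Fop d b D ν γ r g (x + s) := by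
    ext x; exact F_shift ν γ r g s x
  simp only [Tmap, this, cv]
  congr 2; ext y; congr 1; ring

/-- limits of monotone functions at infinity pass through T -/
lemma NL.T_atTop (H : NL d b u D d0 b0 κ) {g : ℝ → ℝ} (h : Adm u g) {L : ℝ} (hL : Tendsto g atTop (nhds L)) :
    Tendsto (Tmap d b D ν γ ρ r g) atTop (nhds (L + (D + 1)⁻¹ * (b L - d L))) := by
  have := H.Ttendsto ν γ ρ r (l := atTop) (g := fun s : ℝ => fun z => g (z + s)) (g' := fun _ => L)
    (fun s => h.shift s) (fun x => hL.comp (tendsto_atTop_add_const_left _ x tendsto_id)) 0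
  rw [T_const ν γ ρ r H.hD] at this
  simpa [T_shift] using this

lemma NL.T_atBot (H : NL d b u D d0 b0 κ) {g : ℝ → ℝ} (h : Adm u g) {L : ℝ} (hL : Tendsto g atBot (nhds L)) :
    Tendsto (Tmap d b D ν γ ρ r g) atBot (nhds (L + (D + 1)⁻¹ * (b L - d L))) := by
  have := H.Ttendsto ν γ ρ r (l := atBot) (g := fun s : ℝ => fun z => g (z + s)) (g' := fun _ => L)
    (fun s => h.shift s) (fun x => hL.comp (tendsto_atBot_add_const_left _ x tendsto_id)) 0
  rw [T_const ν γ ρ r H.hD] at this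
  simpa [T_shift] using this

lemma NL.zero_or (H : NL d b u D d0 b0 κ) {L : ℝ} (hL : L ∈ Icc 0 u) (h : L + (D + 1)⁻¹ * (b L - d L) ≤ L) :
    L = 0 ∨ L = u := by
  have hp : 0 < (D + 1)⁻¹ := inv_pos.2 (by linarith [H.hD])
  by_contra hc
  push Not at hc
  have := H.lt L ⟨lt_of_le_of_ne hL.1 (Ne.symm hc.1), lt_of_le_of_ne hL.2 hc.2⟩
  have : 0 < (D + 1)⁻¹ * (b L - d L) := mul_pos hp (by linarith)
  linarith

/-- The obstacle fixed point. -/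
lemma NL.obstacle (H : NL d b u D d0 b0 κ) {ψ h : ℝ → ℝ} (hψ : Adm u ψ) (hh : Adm u h) (hle : ∀ x, h x ≤ ψ x)
    (hT : ∀ x, Tmap d b D ν γ ρ r ψ x ≤ ψ x) :
    ∃ a, Adm u a ∧ (∀ x, a x ≤ ψ x) ∧ ∀ x, a x = max (Tmap d b D ν γ ρ r a x) (h x) := by
  let S : (ℝ → ℝ) → (ℝ → ℝ) := fun g x => max (Tmap d b D ν γ ρ r g x) (h x)
  let a : ℕ → ℝ → ℝ := fun n => S^[n] h
  have hs : ∀ n, a (n + 1) = S (a n) := fun n => Function.iterate_succ_apply' S n h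
  have hadm : ∀ n, Adm u (a n) := by
    intro n
    induction n with
    | zero => exact hh
    | succ n ih =>
      rw [hs]
      have := H.TAdm ν γ ρ r ih
      exact ⟨this.1.max hh.1, fun x => ⟨le_max_of_le_left (this.2 x).1, max_le (this.2 x).2 (hh.2 x).2⟩⟩
  have hinc : ∀ n x, a n x ≤ a (n + 1) x := by
    intro n
    induction n with
    | zero => intro x; rw [hs]; exact le_max_right _ _
    | succ n ih =>
      intro x
      rw [hs (n + 1), hs n]
      refine max_le_max ?_ le_rfl
      have := H.Tmono ν γ ρ r (hadm n) (hadm (n + 1)) ih x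
      rwa [hs n] at this
  have hup : ∀ n x, a n x ≤ ψ x := by
    intro n
    induction n with
    | zero => exact hle
    | succ n ih =>
      intro x
      rw [hs]
      exact max_le ((H.Tmono ν γ ρ r (hadm n) hψ ih x).trans (hT x)) (hle x)
  have hlim : ∀ x, Tendsto (fun n => a n x) atTop (nhds (⨆ n, a n x)) := fun x =>
    tendsto_atTop_ciSup (monotone_nat_of_le_succ fun n => hinc n x)
      ⟨ψ x, by rintro _ ⟨n, rfl⟩; exact hup n x⟩
  refine ⟨fun x => ⨆ n, a n x, Adm.limit hadm hlim, fun x => le_of_tendsto' (hlim x) fun n => hup n x, fun x => ?_⟩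
  have h1 : Tendsto (fun n => a (n + 1) x) atTop (nhds (⨆ n, a n x)) :=
    (hlim x).comp (tendsto_add_atTop_nat 1)
  refine tendsto_nhds_unique h1 ?_
  simp only [hs]
  exact (H.Ttendsto ν γ ρ r hadm hlim x).max tendsto_const_nhds

end ops

lemma compactness {u L : ℝ} {a : ℕ → ℝ → ℝ} (h : ∀ k, Adm u (a k))
    (hL : ∀ k x y, |a k x - a k y| ≤ L * |x - y|) :
    ∃ s : ℕ → ℕ, StrictMono s ∧ ∃ g : ℝ → ℝ, ∀ x, Tendsto (fun k => a (s k) x) atTop (nhds (g x)) := by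
  have hc : IsCompact (Set.pi univ (fun _ : ℚ => Icc (0 : ℝ) u)) := isCompact_univ_pi fun _ => isCompact_Icc
  obtain ⟨v, -, s, hs, hv⟩ := hc.tendsto_subseq (x := fun k => fun q : ℚ => a k q)
    (fun k q _ => (h k).2 q)
  rw [tendsto_pi_nhds] at hv
  refine ⟨s, hs, ?_⟩
  have : ∀ x, ∃ y, Tendsto (fun k => a (s k) x) atTop (nhds y) := by
    intro x
    apply cauchySeq_tendsto_of_complete
    rw [Metric.cauchySeq_iff']
    intro ε hε
    obtain ⟨q, hq⟩ : ∃ q : ℚ, |x - q| < ε / (4 * (|L| + 1)) := by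
      obtain ⟨q, h1, h2⟩ := exists_rat_btwn (show x < x + ε / (4 * (|L| + 1)) by
        have : 0 < ε / (4 * (|L| + 1)) := by positivity
        linarith)
      exact ⟨q, by rw [abs_lt]; constructor <;> linarith⟩
    have hb : ∀ k, |a k x - a k q| < ε / 4 := by
      intro k
      calc _ ≤ L * |x - q| := hL k x q
        _ ≤ (|L| + 1) * |x - q| := by gcongr; linarith [le_abs_self L]
        _ < (|L| + 1) * (ε / (4 * (|L| + 1))) := by gcongr
        _ = ε / 4 := by field_simp
    obtain ⟨N, hN⟩ := Metric.cauchySeq_iff'.1 (hv q).cauchySeq (ε / 4) (by positivity)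
    refine ⟨N, fun n hn => ?_⟩
    have h1 := hN n hn
    have h2 := hb (s n)
    have h3 := hb (s N)
    rw [Real.dist_eq] at *
    simp only [Function.comp] at h1
    rw [abs_lt] at *
    constructor <;> linarith [h1.1, h1.2, h2.1, h2.2, h3.1, h3.2]
  choose g hg using this
  exact ⟨g, hg⟩


lemma wd_int {μ : Measure ℝ} {w : ℝ → ℝ} (hw : Measurable w) (h0 : ∀ᵐ x ∂μ, 0 ≤ w x) (g : ℝ → ℝ) :
    ∫ x, g x ∂(μ.withDensity fun x => ENNReal.ofReal (w x)) = ∫ x, w x * g x ∂μ := by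
  rw [integral_withDensity_eq_integral_toReal_smul hw.ennreal_ofReal (by simp)]
  refine integral_congr_ae (h0.mono fun x hx => ?_)
  simp [ENNReal.toReal_ofReal hx]

lemma wd_integrable {μ : Measure ℝ} {w : ℝ → ℝ} (hw : Measurable w) (h0 : ∀ᵐ x ∂μ, 0 ≤ w x) (g : ℝ → ℝ) :
    Integrable g (μ.withDensity fun x => ENNReal.ofReal (w x)) ↔ Integrable (fun x => w x * g x) μ := by
  rw [integrable_withDensity_iff_integrable_smul' hw.ennreal_ofReal (by simp)]
  refine integrable_congr (h0.mono fun x hx => ?_)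
  simp [ENNReal.toReal_ofReal hx]

lemma wd_prob {μ : Measure ℝ} {w : ℝ → ℝ} (hw : Integrable w μ) (h0 : ∀ᵐ x ∂μ, 0 ≤ w x)
    (h1 : ∫ x, w x ∂μ = 1) :
    IsProbabilityMeasure (μ.withDensity fun x => ENNReal.ofReal (w x)) := by
  refine ⟨?_⟩
  rw [withDensity_apply _ MeasurableSet.univ, Measure.restrict_univ,
    ← ofReal_integral_eq_lintegral_ofReal hw h0, h1]
  simp

def rhoM (A : ℝ) : Measure ℝ :=
  (volume.restrict (Ioi 0)).withDensity fun s => ENNReal.ofReal (A * exp (-A * s))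

lemma rho_meas (A : ℝ) : Measurable fun s : ℝ => A * exp (-A * s) := by fun_prop

lemma rho_nn {A : ℝ} (hA : 0 < A) : ∀ᵐ s ∂(volume.restrict (Ioi (0:ℝ))), 0 ≤ A * exp (-A * s) :=
  ae_of_all _ fun s => by positivity

lemma rho_prob {A : ℝ} (hA : 0 < A) : IsProbabilityMeasure (rhoM A) := by
  refine wd_prob ?_ (rho_nn hA) ?_
  · exact (integrableOn_exp_mul_Ioi (by linarith) 0).const_mul A
  · rw [integral_const_mul, integral_exp_mul_Ioi (by linarith)]
    simp [hA.ne']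

lemma rho_int {A : ℝ} (hA : 0 < A) (g : ℝ → ℝ) :
    ∫ s, g s ∂(rhoM A) = ∫ s in Ioi 0, A * exp (-A * s) * g s :=
  wd_int (rho_meas A) (rho_nn hA) g

lemma rho_exp {A l : ℝ} (hA : 0 < A) (hl : 0 < l) :
    Integrable (fun s => exp (-l * s)) (rhoM A) ∧ ∫ s, exp (-l * s) ∂(rhoM A) = A / (A + l) := by
  have e : ∀ s, A * exp (-A * s) * exp (-l * s) = A * exp (-(A + l) * s) := by
    intro s; rw [mul_assoc, ← exp_add]; ring_nf
  constructor
  · rw [rhoM, wd_integrable (rho_meas A) (rho_nn hA)]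
    simp only [e]
    exact (integrableOn_exp_mul_Ioi (by linarith) 0).const_mul A
  · rw [rho_int hA]
    simp only [e]
    rw [integral_const_mul, integral_exp_mul_Ioi (by linarith), mul_zero, exp_zero,
      neg_div_neg_eq, mul_one_div]

lemma rho_cv {A : ℝ} (hA : 0 < A) (G : ℝ → ℝ) (x : ℝ) :
    cv (rhoM A) G x = A * exp (-A * x) * ∫ t in Iic x, exp (A * t) * G t := by
  rw [cv, rho_int hA, integral_Iic_eq_integral_Iio, ← integral_indicator measurableSet_Ioi,
    ← integral_const_mul, ← integral_indicator measurableSet_Iio,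
    ← integral_sub_left_eq_self _ volume x]
  congr 1
  ext s
  by_cases hs : s < x
  · have h1 : x - s ∈ Ioi (0:ℝ) := by simp [hs]
    have h2 : s ∈ Iio x := hs
    rw [indicator_of_mem h1, indicator_of_mem h2]
    have : exp (-A * (x - s)) = exp (-A * x) * exp (A * s) := by rw [← exp_add]; ring_nf
    rw [this, sub_sub_cancel]
    ring
  · have h1 : x - s ∉ Ioi (0:ℝ) := by simpa using hs
    have h2 : s ∉ Iio x := hs
    rw [indicator_of_notMem h1, indicator_of_notMem h2]

lemma rho_intOn {A B : ℝ} (hA : 0 < A) {G : ℝ → ℝ} (hG : Adm B G) (x : ℝ) :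
    IntegrableOn (fun t => exp (A * t) * G t) (Iic x) := by
  refine Integrable.mono' ((integrableOn_exp_mul_Iic hA x).mul_const B) ?_ (ae_of_all _ fun t => ?_)
  · have := hG.1.measurable
    exact Measurable.aestronglyMeasurable (by fun_prop)
  · rw [norm_mul, Real.norm_eq_abs, Real.norm_eq_abs, abs_of_pos (exp_pos _), abs_of_nonneg (hG.2 _).1]
    gcongr
    exact (hG.2 _).2

lemma rho_deriv {A B : ℝ} (hA : 0 < A) {G : ℝ → ℝ} (hG : Adm B G) (hc : Continuous G) (x : ℝ) :
    HasDerivAt (cv (rhoM A) G) (A * (G x - cv (rhoM A) G x)) x := by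
  have e : cv (rhoM A) G = fun x => A * exp (-A * x) *
      ((∫ t in Iic 0, exp (A * t) * G t) + ∫ t in (0:ℝ)..x, exp (A * t) * G t) := by
    ext x
    rw [rho_cv hA, ← intervalIntegral.integral_Iic_sub_Iic (rho_intOn hA hG 0) (rho_intOn hA hG x)]
    ring
  have hcont : Continuous fun t => exp (A * t) * G t := by fun_prop
  have h1 : HasDerivAt (fun x => ∫ t in (0:ℝ)..x, exp (A * t) * G t) (exp (A * x) * G x) x :=
    intervalIntegral.integral_hasDerivAt_right (hcont.intervalIntegrable _ _)
      (hcont.stronglyMeasurableAtFilter _ _) hcont.continuousAt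
  have h2 : HasDerivAt (fun x => A * exp (-A * x)) (A * (exp (-A * x) * -A)) x := by
    have := ((hasDerivAt_id x).const_mul (-A)).exp.const_mul A
    simpa using this
  rw [e]
  refine (h2.mul (h1.const_add _)).congr_deriv ?_
  have : exp (-A * x) * exp (A * x) = 1 := by rw [← exp_add]; simp
  linear_combination A * G x * this

lemma rho_lip {A B : ℝ} (hA : 0 < A) {G : ℝ → ℝ} (hG : Adm B G) (x y : ℝ) :
    |cv (rhoM A) G x - cv (rhoM A) G y| ≤ A * B * |x - y| := by
  haveI := rho_prob hA
  wlog hxy : x ≤ y generalizing x y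
  · rw [abs_sub_comm, abs_sub_comm x]; exact this y x (le_of_not_ge hxy)
  have hm := (hG.cv (rhoM A)).1 hxy
  rw [abs_of_nonpos (by linarith), abs_of_nonpos (by linarith)]
  have hB : 0 ≤ B := (hG.2 0).1.trans (hG.2 0).2
  have h0 : 0 ≤ ∫ t in Iic x, exp (A * t) * G t :=
    integral_nonneg fun t => mul_nonneg (exp_pos _).le (hG.2 _).1
  have h1 := intervalIntegral.integral_Iic_sub_Iic (rho_intOn hA hG x) (rho_intOn hA hG y)
  have h2 : ∫ t in x..y, exp (A * t) * G t ≤ ∫ t in x..y, exp (A * y) * B := by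
    refine intervalIntegral.integral_mono_on hxy ?_ (by simp) fun t ht => ?_
    · rw [intervalIntegrable_iff_integrableOn_Ioc_of_le hxy]
      exact (rho_intOn hA hG y).mono_set Ioc_subset_Iic_self
    · have := (hG.2 t)
      have h3 := ht.2
      gcongr
      exacts [this.1, this.2]
  rw [intervalIntegral.integral_const, smul_eq_mul] at h2
  rw [rho_cv hA, rho_cv hA]
  have e1 : exp (-A * y) ≤ exp (-A * x) := exp_le_exp.2 (by nlinarith)
  have e2 : exp (-A * y) * exp (A * y) = 1 := by rw [← exp_add]; simp
  have h3 : ∫ t in Iic y, exp (A * t) * G t ≤ (∫ t in Iic x, exp (A * t) * G t) + (y - x) * (exp (A * y) * B) := by linarith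
  have h4 := mul_le_mul_of_nonneg_left h3 (show 0 ≤ A * exp (-A * y) by positivity)
  have h5 := mul_le_mul_of_nonneg_right (mul_le_mul_of_nonneg_left e1 hA.le) h0
  have e3 : A * exp (-A * y) * ((y - x) * (exp (A * y) * B)) = A * B * (y - x) := by
    linear_combination A * (y - x) * B * e2
  rw [mul_add, e3] at h4
  linarith


lemma cv_le_exp {μ : Measure ℝ} [IsProbabilityMeasure μ] {u C l : ℝ} {g : ℝ → ℝ} (hg : Adm u g)
    (hi : Integrable (fun y => exp (-l * y)) μ) (h : ∀ x, g x ≤ C * exp (l * x)) (x : ℝ) :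
    cv μ g x ≤ C * exp (l * x) * ∫ y, exp (-l * y) ∂μ := by
  rw [cv, ← integral_const_mul]
  refine integral_mono (hg.int μ x) (hi.const_mul _) fun y => (h _).trans (le_of_eq ?_)
  rw [mul_assoc, ← exp_add]
  ring_nf

lemma NL.super {d b : ℝ → ℝ} {u D d0 b0 κ : ℝ} (H : NL d b u D d0 b0 κ)
    (ν γ : Measure ℝ) [IsProbabilityMeasure ν] [IsProbabilityMeasure γ] (r c l : ℝ)
    (hc : 0 < c) (hl : 0 < l)
    (hν : Integrable (fun y => exp (-l * y)) ν) (hγ : Integrable (fun y => exp (-l * y)) γ)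
    (hΔ : b0 * (exp (-l * r) * ∫ y, exp (-l * y) ∂γ) + (∫ y, exp (-l * y) ∂ν) - 1 - c * l - d0 ≤ 0)
    {ψ : ℝ → ℝ} (hψ : Adm u ψ) (hle : ∀ x, ψ x ≤ exp (l * x)) (x : ℝ) :
    Tmap d b D ν γ (rhoM ((D + 1) / c)) r ψ x ≤ exp (l * x) := by
  have hp : 0 < D + 1 := by linarith [H.hD]
  have hA : 0 < (D + 1) / c := by positivity
  haveI := rho_prob hA
  have hF : ∀ x, Fop d b D ν γ r ψ x ≤ (c * l + D + 1) * exp (l * x) := by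
    intro x
    have h1 := cv_le_exp (C := 1) hψ hν (fun x => by simpa using hle x) x
    have h2 := H.d0le _ (hψ.2 x)
    have h3 : (D - d0) * ψ x ≤ (D - d0) * exp (l * x) :=
      mul_le_mul_of_nonneg_left (hle x) (by linarith [H.hd0D])
    have h4 := cv_le_exp (C := b0) (H.bAdm hψ) hγ (fun x => (H.b0le _ (hψ.2 x)).trans
      (mul_le_mul_of_nonneg_left (hle x) H.hb0.le)) (x - r)
    have e : exp (l * (x - r)) = exp (l * x) * exp (-l * r) := by rw [← exp_add]; ring_nf
    rw [e] at h4
    have h5 := mul_le_mul_of_nonneg_right hΔ (exp_pos (l * x)).le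
    simp only [Fop]
    nlinarith
  have h := cv_le_exp (H.FAdm ν γ r hψ) (rho_exp hA hl).1 hF x
  rw [(rho_exp hA hl).2] at h
  rw [Tmap, inv_mul_le_iff₀ hp]
  refine h.trans (le_of_eq ?_)
  have : D + 1 + c * l ≠ 0 := by positivity
  have h2 : (D + 1) / c + l ≠ 0 := by positivity
  field_simp
  ring

theorem NL.exists_wave {d b : ℝ → ℝ} {u D d0 b0 κ : ℝ} (H : NL d b u D d0 b0 κ)
    (ν γ : Measure ℝ) [IsProbabilityMeasure ν] [IsProbabilityMeasure γ] (r c l : ℝ)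
    (hc : 0 < c) (hl : 0 < l)
    (hν : Integrable (fun y => exp (-l * y)) ν) (hγ : Integrable (fun y => exp (-l * y)) γ)
    (hΔ : b0 * (exp (-l * r) * ∫ y, exp (-l * y) ∂γ) + (∫ y, exp (-l * y) ∂ν) - 1 - c * l - d0 ≤ 0) :
    ∃ phi phid : ℝ → ℝ, Monotone phi ∧ (∀ x, HasDerivAt phi (phid x) x) ∧ Continuous phid ∧
      Tendsto phi atBot (nhds 0) ∧ Tendsto phi atTop (nhds u) ∧
      ∀ x, c * phid x - cv ν phi x + phi x + d (phi x) = cv γ (fun z => b (phi z)) (x - r) := by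
  have hp : 0 < D + 1 := by linarith [H.hD]
  have hu := H.hu
  have hA : 0 < (D + 1) / c := by positivity
  haveI := rho_prob hA
  set A := (D + 1) / c with hAdef
  set T := Tmap d b D ν γ (rhoM A) r with hTdef
  have hTlip : ∀ g, Adm u g → ∀ x y, |T g x - T g y| ≤ A * u * |x - y| := by
    intro g hg x y
    have := rho_lip hA (H.FAdm ν γ r hg) x y
    simp only [hTdef, Tmap]
    rw [← mul_sub, abs_mul, abs_of_pos (inv_pos.2 hp), inv_mul_le_iff₀ hp]
    linarith
  have hlim0 : ∀ g, Adm u g → ∃ L ∈ Icc 0 u, Tendsto g atBot (nhds L) ∧ ∀ x, L ≤ g x := by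
    intro g hg
    have hb : BddBelow (range g) := ⟨0, by rintro _ ⟨x, rfl⟩; exact (hg.2 x).1⟩
    have := tendsto_atBot_ciInf hg.1 hb
    exact ⟨_, isClosed_Icc.mem_of_tendsto this (Eventually.of_forall hg.2), this, fun x => ciInf_le hb x⟩
  have hlim1 : ∀ g, Adm u g → ∃ L ∈ Icc 0 u, Tendsto g atTop (nhds L) ∧ ∀ x, g x ≤ L := by
    intro g hg
    have hb : BddAbove (range g) := ⟨u, by rintro _ ⟨x, rfl⟩; exact (hg.2 x).2⟩
    have := tendsto_atTop_ciSup hg.1 hb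
    exact ⟨_, isClosed_Icc.mem_of_tendsto this (Eventually.of_forall hg.2), this, fun x => le_ciSup hb x⟩
  -- super solution
  let ψ : ℝ → ℝ := fun x => min u (exp (l * x))
  have hψ : Adm u ψ := by
    refine ⟨fun x y hxy => min_le_min le_rfl (exp_le_exp.2 (by nlinarith)), fun x => ⟨le_min hu.le (exp_pos _).le, min_le_left _ _⟩⟩
  have hTψ : ∀ x, T ψ x ≤ ψ x := fun x =>
    le_min ((H.TAdm ν γ (rhoM A) r hψ).2 x).2
      (H.super ν γ r c l hc hl hν hγ hΔ hψ (fun x => min_le_right _ _) x)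
  have hψ0 : Tendsto ψ atBot (nhds 0) := by
    have h1 : Tendsto (fun x : ℝ => exp (l * x)) atBot (nhds 0) :=
      tendsto_exp_atBot.comp (tendsto_id.const_mul_atBot hl)
    exact squeeze_zero (fun x => (hψ.2 x).1) (fun x => min_le_right _ _) h1
  -- approximate solutions
  have step : ∀ k : ℕ, ∃ a, Adm u a ∧ a 0 = u / 2 ∧
      (∀ x y, |a x - a y| ≤ max (A * u) 1 * |x - y|) ∧ ∀ x, |a x - T a x| ≤ 1 / ((k : ℝ) + 1) := by
    intro k
    set e : ℝ := min (min u 1) (1 / ((k : ℝ) + 1)) with he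
    have hk : (0:ℝ) < 1 / ((k : ℝ) + 1) := by positivity
    have he0 : 0 < e := lt_min (lt_min hu one_pos) hk
    have heu : e ≤ u := (min_le_left _ _).trans (min_le_left _ _)
    have he1 : e ≤ 1 := (min_le_left _ _).trans (min_le_right _ _)
    have hek : e ≤ 1 / ((k : ℝ) + 1) := min_le_right _ _
    let h : ℝ → ℝ := fun x => max 0 (min e x)
    have hhe : ∀ x, h x ≤ e := fun x => max_le he0.le (min_le_left _ _)
    have hh0 : ∀ x, 0 ≤ h x := fun x => le_max_left _ _
    have hh : Adm u h := ⟨fun x y hxy => max_le_max le_rfl (min_le_min le_rfl hxy), fun x =>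
      ⟨hh0 x, (hhe x).trans heu⟩⟩
    have hlip : ∀ x y, |h x - h y| ≤ |x - y| := by
      intro x y
      refine (abs_max_sub_max_le_max _ _ _ _).trans ?_
      simp only [sub_self, abs_zero]
      refine max_le (abs_nonneg _) ((abs_min_sub_min_le_max _ _ _ _).trans ?_)
      simp
    have hhψ : ∀ x, h x ≤ ψ x := by
      intro x
      rcases le_or_gt x 0 with hx | hx
      · have : h x = 0 := max_eq_left ((min_le_right _ _).trans hx)
        rw [this]; exact (hψ.2 x).1
      · refine (hhe x).trans (le_min heu (he1.trans ?_))
        exact one_le_exp (by positivity)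
    obtain ⟨a, ha, haψ, hfix⟩ := H.obstacle ν γ (rhoM A) r hψ hh hhψ hTψ
    have hal : ∀ x y, |a x - a y| ≤ max (A * u) 1 * |x - y| := by
      intro x y
      rw [hfix x, hfix y]
      refine (abs_max_sub_max_le_max _ _ _ _).trans (max_le ?_ ?_)
      · exact (hTlip a ha x y).trans (mul_le_mul_of_nonneg_right (le_max_left _ _) (abs_nonneg _))
      · refine (hlip x y).trans ?_
        have := mul_le_mul_of_nonneg_right (le_max_right (A * u) 1) (abs_nonneg (x - y))
        linarith
    have hcont : Continuous a := by
      refine (LipschitzWith.of_dist_le_mul (K := (max (A * u) 1).toNNReal) fun x y => ?_).continuous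
      rw [Real.dist_eq, Real.dist_eq, Real.coe_toNNReal _ (le_max_of_le_right zero_le_one)]
      exact hal x y
    have hb : Tendsto a atBot (nhds 0) := squeeze_zero (fun x => (ha.2 x).1) haψ hψ0
    obtain ⟨L, hL, haL, hLle⟩ := hlim1 a ha
    have hLu : L = u := by
      have h1 := H.T_atTop ν γ (rhoM A) r ha haL
      have h2 := le_of_tendsto_of_tendsto' h1 haL fun x => by rw [hfix x]; exact le_max_left _ _
      rcases H.zero_or hL h2 with h3 | h3
      · exfalso
        have h4 : h e ≤ a e := by rw [hfix e]; exact le_max_right _ _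
        have h5 : h e = e := by simp [h, he0.le]
        have := hLle e
        linarith
      · exact h3
    rw [hLu] at haL
    obtain ⟨s, hs⟩ : ∃ s, a s = u / 2 := by
      obtain ⟨x, hx⟩ := (hb.eventually (gt_mem_nhds (show (0:ℝ) < u / 2 by linarith))).exists
      obtain ⟨y, hy⟩ := (haL.eventually (lt_mem_nhds (show u / 2 < u by linarith))).exists
      exact mem_range_of_exists_le_of_exists_ge hcont ⟨x, hx.le⟩ ⟨y, hy.le⟩
    refine ⟨fun x => a (x + s), ha.shift s, by simpa using hs, fun x y => ?_, fun x => ?_⟩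
    · have := hal (x + s) (y + s)
      simpa using this
    · simp only [hTdef]
      rw [T_shift, hfix (x + s)]
      rw [abs_of_nonneg (by linarith [le_max_left (Tmap d b D ν γ (rhoM A) r a (x + s)) (h (x + s))])]
      have h1 := ((H.TAdm ν γ (rhoM A) r ha).2 (x + s)).1
      rw [sub_le_iff_le_add]
      refine max_le (by linarith) ?_
      linarith [hhe (x + s)]
  choose a ha ha0 hal haT using step
  obtain ⟨s, hs, g, hg⟩ := compactness ha hal
  have hgA : Adm u g := Adm.limit (fun k => ha (s k)) hg
  have hg0 : g 0 = u / 2 := tendsto_nhds_unique (hg 0) (by simp [ha0])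
  have hgT : ∀ x, T g x = g x := by
    intro x
    have h1 := (hg x).sub (H.Ttendsto ν γ (rhoM A) r (fun k => ha (s k)) hg x)
    have h2 : Tendsto (fun k => a (s k) x - T (a (s k)) x) atTop (nhds 0) := by
      refine squeeze_zero_norm (fun k => haT (s k) x) ?_
      exact (tendsto_one_div_add_atTop_nhds_zero_nat (𝕜 := ℝ)).comp hs.tendsto_atTop
    have := tendsto_nhds_unique h1 h2
    linarith
  have hgc : Continuous g := by
    refine (LipschitzWith.of_dist_le_mul (K := (A * u).toNNReal) fun x y => ?_).continuous
    rw [Real.dist_eq, Real.dist_eq, Real.coe_toNNReal _ (by positivity), ← hgT x, ← hgT y]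
    exact hTlip g hgA x y
  have hgTf : Tmap d b D ν γ (rhoM A) r g = g := funext hgT
  have hFc : Continuous (Fop d b D ν γ r g) := by
    rw [continuous_iff_continuousAt]
    intro x
    have := H.Ftendsto ν γ r (l := nhds x) (g := fun s => fun z => g (z + (s - x))) (g' := g)
      (fun s => hgA.shift _) (fun z => by
        have : ContinuousAt (fun s => g (z + (s - x))) x := by fun_prop
        simpa [ContinuousAt] using this) x
    simp only [F_shift] at this
    simpa [ContinuousAt] using this
  have hD1 : D + 1 ≠ 0 := hp.ne'
  have hcv : ∀ x, cv (rhoM A) (Fop d b D ν γ r g) x = (D + 1) * g x := by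
    intro x
    have := hgT x
    simp only [hTdef, Tmap] at this
    rw [← this]
    field_simp
  refine ⟨g, fun x => c⁻¹ * (Fop d b D ν γ r g x - (D + 1) * g x), hgA.1, fun x => ?_, by fun_prop, ?_, ?_, fun x => ?_⟩
  · have := (rho_deriv hA (H.FAdm ν γ r hgA) hFc x).const_mul ((D + 1)⁻¹)
    have e : (fun y => (D + 1)⁻¹ * cv (rhoM A) (Fop d b D ν γ r g) y) = g := by
      ext y; exact hgT y
    rw [e, hcv x] at this
    refine this.congr_deriv ?_
    rw [hAdef]
    field_simp
  · obtain ⟨L, hL, h1, h2⟩ := hlim0 g hgA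
    have h3 := H.T_atBot ν γ (rhoM A) r hgA h1
    rw [hgTf] at h3
    have h4 := tendsto_nhds_unique h3 h1
    rcases H.zero_or hL h4.le with h5 | h5
    · rwa [h5] at h1
    · have := h2 0; linarith
  · obtain ⟨L, hL, h1, h2⟩ := hlim1 g hgA
    have h3 := H.T_atTop ν γ (rhoM A) r hgA h1
    rw [hgTf] at h3
    have h4 := tendsto_nhds_unique h3 h1
    rcases H.zero_or hL h4.le with h5 | h5
    · have := h2 0; linarith
    · rwa [h5] at h1
  · have : c * (c⁻¹ * (Fop d b D ν γ r g x - (D + 1) * g x)) = Fop d b D ν γ r g x - (D + 1) * g x := by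
      field_simp
    rw [this]
    simp only [Fop]
    ring


lemma cv_ge {μ : Measure ℝ} [IsProbabilityMeasure μ] {u : ℝ} {g : ℝ → ℝ} (hg : Adm u g) (x R : ℝ) :
    μ.real (Iic (-R)) * g (x + R) ≤ cv μ g x := by
  have h1 : ∫ y, (Iic (-R)).indicator (fun _ => g (x + R)) y ∂μ = μ.real (Iic (-R)) * g (x + R) := by
    rw [integral_indicator measurableSet_Iic]; simp
  rw [← h1]
  refine integral_mono ((integrable_const _).indicator measurableSet_Iic) (hg.int μ x) fun y => ?_
  by_cases hy : y ∈ Iic (-R)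
  · rw [indicator_of_mem hy]
    exact hg.1 (by have : y ≤ -R := hy; linarith)
  · rw [indicator_of_notMem hy]
    exact (hg.2 _).1

/-- Touching from below by a parabola. -/
lemma touch {q : ℝ → ℝ} (hq : Continuous q) (hm : Monotone q) {ℓ : ℝ} (hℓ : 0 ≤ ℓ)
    (h1 : ∀ x, q (x + 1) - ℓ ≤ q x) {ε : ℝ} (hε : 0 < ε) (x1 : ℝ) :
    ∃ x0 ≤ x1, ∃ g, 0 ≤ g ∧ g ≤ 4 * ℓ + 2 * ε ∧ ∀ z, q x0 - g * z - ε * z ^ 2 ≤ q (x0 - z) ∧ g = 2 * ε * (x1 - x0) := by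
  have hn : ∀ (n : ℕ) x, q x - n * ℓ ≤ q (x - n) := by
    intro n
    induction n with
    | zero => intro x; simp
    | succ n ih =>
      intro x
      have e1 := ih x
      have e2 := h1 (x - n - 1)
      rw [sub_add_cancel] at e2
      push_cast
      rw [show x - ((n:ℝ) + 1) = x - n - 1 by ring]
      linarith
  have hs : ∀ s ≥ 0, ∀ x, q x - (s + 1) * ℓ ≤ q (x - s) := by
    intro s hs x
    have e1 := hn ⌈s⌉₊ x
    have e2 : q (x - ⌈s⌉₊) ≤ q (x - s) := hm (by linarith [Nat.le_ceil s])
    have e3 : (⌈s⌉₊ : ℝ) * ℓ ≤ (s + 1) * ℓ :=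
      mul_le_mul_of_nonneg_right (Nat.ceil_lt_add_one hs).le hℓ
    linarith
  set S := 2 * ℓ / ε + 1 with hS
  have hS1 : 1 ≤ S := by have : 0 ≤ 2 * ℓ / ε := by positivity
                         linarith
  let p : ℝ → ℝ := fun x => q x + ε * (x - x1) ^ 2
  obtain ⟨x0, hx0, hmin⟩ := (isCompact_Icc (a := x1 - S) (b := x1)).exists_isMinOn
    ⟨x1, by constructor <;> linarith⟩ (f := p) (by fun_prop)
  have hp1 : p x0 ≤ p x1 := hmin ⟨by linarith, le_rfl⟩
  have hglob : ∀ x, p x0 ≤ p x := by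
    intro x
    by_cases hx : x ∈ Icc (x1 - S) x1
    · exact hmin hx
    · refine hp1.trans ?_
      simp only [p, sub_self]
      rcases le_or_gt x x1 with h | h
      · have h2 : S < x1 - x := by
          by_contra hc
          exact hx ⟨by linarith, h⟩
        have h3 := hs (x1 - x) (by linarith) x1
        rw [sub_sub_cancel] at h3
        have h4 : 2 * ℓ ≤ ε * (x1 - x) := by
          have : 2 * ℓ / ε ≤ x1 - x := by linarith
          rw [div_le_iff₀ hε] at this
          linarith
        nlinarith
      · have := hm h.le
        nlinarith [sq_nonneg (x - x1)]
  have hle : x0 ≤ x1 := hx0.2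
  refine ⟨x0, hle, 2 * ε * (x1 - x0), by have : 0 ≤ x1 - x0 := by linarith
                                         positivity, ?_, fun z => ⟨?_, rfl⟩⟩
  · have h5 : x1 - x0 ≤ S := by linarith [hx0.1]
    calc 2 * ε * (x1 - x0) ≤ 2 * ε * S := by gcongr
      _ = 4 * ℓ + 2 * ε := by rw [hS]; field_simp; ring
  · have := hglob (x0 - z)
    simp only [p] at this
    nlinarith

theorem NL.no_wave {d b : ℝ → ℝ} {u D d0 b0 κ : ℝ} (H : NL d b u D d0 b0 κ)
    (ν γ : Measure ℝ) [IsProbabilityMeasure ν] [IsProbabilityMeasure γ] (r c : ℝ)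
    (hν : ∀ l, Integrable (fun y => exp (l * y)) ν) (hγ : ∀ l, Integrable (fun y => exp (l * y)) γ)
    (hpos : ∀ R, 0 < γ.real (Iic R))
    {phi phid : ℝ → ℝ} (hm : Monotone phi) (hd : ∀ x, HasDerivAt phi (phid x) x)
    (hb : Tendsto phi atBot (nhds 0)) (ht : Tendsto phi atTop (nhds u))
    (heq : ∀ x, c * phid x - cv ν phi x + phi x + d (phi x) = cv γ (fun z => b (phi z)) (x - r)) :
    ∃ l ≥ 0, b0 * (exp (-l * r) * ∫ y, exp (-l * y) ∂γ) + (∫ y, exp (-l * y) ∂ν) - 1 - c * l - d0 ≤ 0 := by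
  have hu := H.hu
  have hA : Adm u phi := ⟨hm, fun x => ⟨hm.le_of_tendsto hb x, hm.ge_of_tendsto ht x⟩⟩
  have hcont : Continuous phi := continuous_iff_continuousAt.2 fun x => (hd x).continuousAt
  have hdu : ∀ x, d (phi x) ≤ D * phi x := fun x => by
    have := ((H.dAdm hA).2 x).1; linarith
  have hκ := H.hκ
  -- basic lower bound
  have hcvb : ∀ x, κ * cv γ phi x ≤ cv γ (fun z => b (phi z)) x := by
    intro x
    rw [cv, ← integral_const_mul]
    exact integral_mono ((hA.int γ x).const_mul _) ((H.bAdm hA).int γ x) fun y => H.κle _ (hA.2 _)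
  have hlow : ∀ R x, κ * (γ.real (Iic (-R)) * phi (x - r + R)) ≤ c * phid x + phi x + d (phi x) := by
    intro R x
    have h1 := mul_le_mul_of_nonneg_left (cv_ge (μ := γ) hA (x - r) R) hκ.le
    have h2 := hcvb (x - r)
    have h3 := ((hA.cv ν).2 x).1
    have h4 := heq x
    linarith
  have hφpos : ∀ x, 0 < phi x := by
    intro x
    by_contra hc
    have h0 : phi x = 0 := le_antisymm (not_lt.1 hc) (hA.2 x).1
    have hd0 : phid x = 0 := IsLocalMin.hasDerivAt_eq_zero
      (Eventually.of_forall fun y => by rw [h0]; exact (hA.2 y).1) (hd x)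
    obtain ⟨y, hy⟩ := (ht.eventually (lt_mem_nhds hu)).exists
    have h1 := hlow (y - x + r) x
    rw [h0, hd0, H.dz, show x - r + (y - x + r) = y by ring] at h1
    have h2 := mul_pos hκ (mul_pos (hpos (-(y - x + r))) hy)
    linarith
  -- Harnack
  obtain ⟨C, hC1, hC⟩ : ∃ C : ℝ, 1 ≤ C ∧ ∀ x, phi (x + 1) ≤ C * phi x := by
    set R := 2 + |r| with hR
    have hδ := hpos (-R)
    set δ := γ.real (Iic (-R)) with hδd
    have hkd : 0 < κ * δ := mul_pos hκ hδ
    refine ⟨max 1 ((|c| + 1 + D) / (κ * δ)), le_max_left _ _, fun x => ?_⟩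
    obtain ⟨s, hs, hs2⟩ := exists_hasDerivAt_eq_slope phi phid (show x - 1 < x by linarith)
      hcont.continuousOn (fun z _ => hd z)
    rw [sub_sub_cancel, div_one] at hs2
    have h1 := hlow R s
    have h2 : phi (x + 1) ≤ phi (s - r + R) := hm (by rw [hR]; linarith [le_abs_self r, hs.1])
    have h3 : κ * (δ * phi (x + 1)) ≤ κ * (δ * phi (s - r + R)) := by gcongr
    have h4 := hdu s
    have h5 : phi s ≤ phi x := hm hs.2.le
    have h6 : D * phi s ≤ D * phi x := mul_le_mul_of_nonneg_left h5 H.hD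
    have h7 : c * phid s ≤ |c| * phi x := by
      rw [hs2]
      have h8 := hm (show x - 1 ≤ x by linarith)
      have h9 := hφpos (x - 1)
      calc c * (phi x - phi (x - 1)) ≤ |c| * (phi x - phi (x - 1)) :=
            mul_le_mul_of_nonneg_right (le_abs_self c) (by linarith)
        _ ≤ |c| * phi x := mul_le_mul_of_nonneg_left (by linarith) (abs_nonneg c)
    have h10 : phi (x + 1) ≤ (|c| + 1 + D) / (κ * δ) * phi x := by
      rw [div_mul_eq_mul_div, le_div_iff₀ hkd]
      nlinarith
    exact h10.trans (mul_le_mul_of_nonneg_right (le_max_right _ _) (hφpos x).le)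
  set ℓ := Real.log C with hℓ
  have hℓ0 : 0 ≤ ℓ := Real.log_nonneg hC1
  let q : ℝ → ℝ := fun x => Real.log (phi x)
  have hqc : Continuous q := hcont.log fun x => (hφpos x).ne'
  have hqm : Monotone q := fun x y hxy => Real.log_le_log (hφpos x) (hm hxy)
  have hq1 : ∀ x, q (x + 1) - ℓ ≤ q x := by
    intro x
    have := Real.log_le_log (hφpos (x + 1)) (hC x)
    rw [Real.log_mul (by linarith) (hφpos x).ne'] at this
    simp only [q]; linarith
  set Γ := 4 * ℓ + 2 with hΓ
  have hΓ0 : 0 ≤ Γ := by positivity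
  -- touching points
  have hstep : ∀ k : ℕ, ∃ x0 ≤ -(k : ℝ), ∃ g ∈ Icc 0 Γ, phid x0 = g * phi x0 ∧
      ∀ z, exp (-g * z - (1 / ((k:ℝ) + 1)) * z ^ 2) * phi x0 ≤ phi (x0 - z) := by
    intro k
    set ε : ℝ := 1 / ((k:ℝ) + 1) with hε
    have hε0 : 0 < ε := by positivity
    have hε1 : ε ≤ 1 := by
      rw [hε, div_le_one (by positivity)]
      have : (0:ℝ) ≤ k := k.cast_nonneg
      linarith
    obtain ⟨x0, hx0, g, hg0, hg1, hz⟩ := touch hqc hqm hℓ0 hq1 hε0 (-(k:ℝ))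
    refine ⟨x0, hx0, g, ⟨hg0, by rw [hΓ]; linarith⟩, ?_, fun z => ?_⟩
    · have h1 : HasDerivAt (fun x => q x - g * (x - x0) + ε * (x - x0) ^ 2)
          (phid x0 / phi x0 - g * 1 + ε * (2 * (x0 - x0) ^ 1 * 1)) x0 := by
        refine HasDerivAt.add (HasDerivAt.sub ((hd x0).log (hφpos x0).ne') ?_) ?_
        · exact ((hasDerivAt_id x0).sub_const x0).const_mul g
        · exact (((hasDerivAt_id x0).sub_const x0).pow 2).const_mul ε
      have h2 := IsLocalMin.hasDerivAt_eq_zero (Eventually.of_forall fun y => by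
        have := (hz (x0 - y)).1
        rw [sub_sub_cancel] at this
        simp only [sub_self]
        nlinarith) h1
      simp only [sub_self] at h2
      have h3 : phid x0 / phi x0 = g := by linarith
      rwa [div_eq_iff (hφpos x0).ne'] at h3
    · have := (hz z).1
      rw [← exp_log (hφpos (x0 - z))]
      nth_rewrite 1 [← exp_log (hφpos x0)]
      rw [← exp_add, exp_le_exp]
      simp only [q] at this
      linarith
  choose X hX G hG hGd hGz using hstep
  -- ratio function for b
  let B : ℝ → ℝ := fun x => b (phi x) / phi x
  have hBm : Measurable B := (H.bAdm hA).1.measurable.div hm.measurable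
  have hB0 : ∀ x, 0 ≤ B x := fun x => div_nonneg ((H.bAdm hA).2 x).1 (hφpos x).le
  have hB1 : ∀ x, B x ≤ b0 := fun x => by
    rw [div_le_iff₀ (hφpos x)]; exact H.b0le _ (hA.2 x)
  have hphi0 : Tendsto phi atBot (nhdsWithin 0 {0}ᶜ) :=
    tendsto_nhdsWithin_iff.2 ⟨hb, Eventually.of_forall fun x => (hφpos x).ne'⟩
  have hBl : Tendsto B atBot (nhds b0) := by
    have h1 := (hasDerivAt_iff_tendsto_slope.1 H.hbd).comp hphi0
    refine h1.congr fun x => ?_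
    simp [slope_def_field, H.bz, B]
  have hDl : Tendsto (fun x => d (phi x) / phi x) atBot (nhds d0) := by
    have h1 := (hasDerivAt_iff_tendsto_slope.1 H.hdd).comp hphi0
    refine h1.congr fun x => ?_
    simp [slope_def_field, H.dz]
  let E : ℕ → ℝ → ℝ := fun k z => exp (-G k * z - (1 / ((k:ℝ) + 1)) * z ^ 2)
  have hEb : ∀ k z, E k z ≤ exp (Γ * |z|) := by
    intro k z
    refine exp_le_exp.2 ?_
    have h1 : -G k * z ≤ G k * |z| := by
      have := mul_le_mul_of_nonneg_left (neg_abs_le z) (hG k).1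
      nlinarith
    have h2 : G k * |z| ≤ Γ * |z| := mul_le_mul_of_nonneg_right (hG k).2 (abs_nonneg z)
    have h3 : 0 ≤ (1 / ((k:ℝ) + 1)) * z ^ 2 := by positivity
    linarith
  have hEm : ∀ k, Continuous (E k) := fun k => by fun_prop
  have hexpabs : ∀ (μ : Measure ℝ), (∀ l, Integrable (fun y => exp (l * y)) μ) →
      ∀ s, Integrable (fun y => exp (Γ * |y + s|)) μ := by
    intro μ hμ s
    refine Integrable.mono' (((hμ Γ).const_mul (exp (Γ * |s|))).add ((hμ (-Γ)).const_mul (exp (Γ * |s|))))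
      (Continuous.aestronglyMeasurable (by fun_prop)) (ae_of_all _ fun y => ?_)
    rw [Real.norm_eq_abs, abs_of_pos (exp_pos _)]
    have h1 : exp (Γ * |y + s|) ≤ exp (Γ * |s|) * exp (Γ * |y|) := by
      rw [← exp_add, exp_le_exp]
      have := mul_le_mul_of_nonneg_left (abs_add_le y s) hΓ0
      linarith
    refine h1.trans ?_
    simp only [Pi.add_apply]
    rw [← mul_add]
    refine mul_le_mul_of_nonneg_left ?_ (exp_pos _).le
    rcases abs_cases y with h | h <;> rw [h.1]
    · linarith [exp_pos (-Γ * y)]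
    · rw [mul_neg, ← neg_mul]; linarith [exp_pos (Γ * y)]
  have hineq : ∀ k, (∫ y, E k (y + 0) ∂ν) - 1 - d (phi (X k)) / phi (X k)
      + (∫ y, B (X k - r - y) * E k (y + r) ∂γ) ≤ c * G k := by
    intro k
    have hp := hφpos (X k)
    have h1 : (∫ y, E k (y + 0) ∂ν) * phi (X k) ≤ cv ν phi (X k) := by
      rw [cv, ← integral_mul_const]
      refine integral_mono_of_nonneg (ae_of_all _ fun y => by positivity) (hA.int ν _) (ae_of_all _ fun y => ?_)
      show E k (y + 0) * phi (X k) ≤ phi (X k - y)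
      rw [add_zero]; exact hGz k y
    have h2 : (∫ y, B (X k - r - y) * E k (y + r) ∂γ) * phi (X k) ≤ cv γ (fun z => b (phi z)) (X k - r) := by
      rw [cv, ← integral_mul_const]
      refine integral_mono_of_nonneg (ae_of_all _ fun y => ?_) ((H.bAdm hA).int γ _) (ae_of_all _ fun y => ?_)
      · exact mul_nonneg (mul_nonneg (hB0 _) (exp_pos _).le) hp.le
      · have h3 := mul_le_mul_of_nonneg_left (hGz k (y + r)) (hB0 (X k - r - y))
        rw [show X k - (y + r) = X k - r - y by ring] at h3
        have h4 : B (X k - r - y) * phi (X k - r - y) = b (phi (X k - r - y)) :=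
          div_mul_cancel₀ _ (hφpos _).ne'
        simp only [E]
        linarith
    have h3 := heq (X k)
    rw [hGd k] at h3
    have h4 : d (phi (X k)) / phi (X k) * phi (X k) = d (phi (X k)) := div_mul_cancel₀ _ hp.ne'
    refine le_of_mul_le_mul_right ?_ hp
    linarith
  obtain ⟨l, hl, s, hs, hsl⟩ := (isCompact_Icc (a := (0:ℝ)) (b := Γ)).tendsto_subseq hG
  refine ⟨l, hl.1, ?_⟩
  have hXt : Tendsto (fun k => X (s k)) atTop atBot := by
    refine tendsto_atBot_mono (fun k => hX (s k)) ?_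
    exact tendsto_neg_atTop_atBot.comp (tendsto_natCast_atTop_atTop.comp hs.tendsto_atTop)
  have hε : Tendsto (fun k => 1 / ((s k : ℝ) + 1)) atTop (nhds 0) :=
    (tendsto_one_div_add_atTop_nhds_zero_nat (𝕜 := ℝ)).comp hs.tendsto_atTop
  have hEl : ∀ z, Tendsto (fun k => E (s k) z) atTop (nhds (exp (-l * z))) := by
    intro z
    have h1 : Tendsto (fun k => -G (s k) * z - 1 / ((s k : ℝ) + 1) * z ^ 2) atTop
        (nhds (-l * z - 0 * z ^ 2)) := (hsl.neg.mul_const z).sub (hε.mul_const _)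
    rw [zero_mul, sub_zero] at h1
    exact (continuous_exp.tendsto _).comp h1
  have L1 : Tendsto (fun k => ∫ y, E (s k) (y + 0) ∂ν) atTop (nhds (∫ y, exp (-l * (y + 0)) ∂ν)) := by
    refine tendsto_integral_of_dominated_convergence (fun y => exp (Γ * |y + 0|))
      (fun k => ((hEm (s k)).comp (by fun_prop)).aestronglyMeasurable) (hexpabs ν hν 0)
      (fun k => ae_of_all _ fun y => ?_) (ae_of_all _ fun y => hEl _)
    rw [Real.norm_eq_abs, abs_of_pos (exp_pos _)]
    exact hEb _ _
  have L2 : Tendsto (fun k => ∫ y, B (X (s k) - r - y) * E (s k) (y + r) ∂γ) atTop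
      (nhds (∫ y, b0 * exp (-l * (y + r)) ∂γ)) := by
    refine tendsto_integral_of_dominated_convergence (fun y => b0 * exp (Γ * |y + r|))
      (fun k => ?_) ((hexpabs γ hγ r).const_mul b0)
      (fun k => ae_of_all _ fun y => ?_) (ae_of_all _ fun y => ?_)
    · have := hEm (s k)
      exact Measurable.aestronglyMeasurable ((hBm.comp (by fun_prop)).mul (by fun_prop))
    · rw [Real.norm_eq_abs, abs_of_nonneg (mul_nonneg (hB0 _) (exp_pos _).le)]
      exact mul_le_mul (hB1 _) (hEb _ _) (exp_pos _).le H.hb0.le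
    · refine Tendsto.mul (hBl.comp ?_) (hEl _)
      have := tendsto_atBot_add_const_right _ (-r - y) hXt
      refine this.congr fun k => by ring
  have L3 := ((L1.sub_const 1).sub (hDl.comp hXt)).add L2
  have fin := le_of_tendsto_of_tendsto' L3 (hsl.const_mul c) fun k => hineq (s k)
  have e : ∫ y, b0 * exp (-l * (y + r)) ∂γ = b0 * (exp (-l * r) * ∫ y, exp (-l * y) ∂γ) := by
    rw [integral_const_mul]
    congr 1
    rw [← integral_const_mul]
    refine integral_congr_ae (ae_of_all _ fun y => ?_)
    show exp (-l * (y + r)) = exp (-l * r) * exp (-l * y)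
    rw [← exp_add]; ring_nf
  rw [e] at fin
  simp only [add_zero] at fin
  linarith


def Dl (M : ℝ → ℝ) (b0 d0 τ β l c : ℝ) : ℝ :=
  b0 * exp (β * l ^ 2 - l * c * τ) + M l - 1 - c * l - d0

lemma Dl_anti {M : ℝ → ℝ} {b0 d0 τ β l : ℝ} (hb : 0 < b0) (hτ : 0 ≤ τ) (hl : 0 ≤ l) {c c' : ℝ}
    (h : c ≤ c') : Dl M b0 d0 τ β l c' ≤ Dl M b0 d0 τ β l c := by
  unfold Dl
  have h1 : exp (β * l ^ 2 - l * c' * τ) ≤ exp (β * l ^ 2 - l * c * τ) := by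
    apply exp_le_exp.2
    have : l * c * τ ≤ l * c' * τ := by gcongr
    linarith
  have h2 : b0 * exp (β * l ^ 2 - l * c' * τ) ≤ b0 * exp (β * l ^ 2 - l * c * τ) := by gcongr
  have h3 : c * l ≤ c' * l := by gcongr
  linarith

lemma crit {M : ℝ → ℝ} {b0 d0 τ β : ℝ} (hMc : Continuous M) (hM1 : ∀ l, 1 ≤ M l)
    (hd : 0 ≤ d0) (hb : d0 < b0) (hτ : 0 ≤ τ) (hβ : 0 < β) :
    ∃ cs > (0:ℝ), ∃ ls > (0:ℝ), Dl M b0 d0 τ β ls cs = 0 ∧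
      (∀ l, 0 ≤ l → ∀ c < cs, 0 < Dl M b0 d0 τ β l c) ∧ (∀ l, 0 ≤ l → 0 ≤ Dl M b0 d0 τ β l cs) := by
  have hb0 : 0 < b0 := by linarith
  set C := b0 * exp β + M 1 with hC
  have hC0 : 0 < C := by have := hM1 1; positivity
  set L := (C + b0 * C * τ) / (b0 * β) with hL
  have hcD : Continuous fun p : ℝ × ℝ => Dl M b0 d0 τ β p.1 p.2 := by
    unfold Dl; fun_prop
  have hbd : ∀ l c, 0 ≤ l → c ≤ C → Dl M b0 d0 τ β l c ≤ 0 → l ≤ L := by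
    intro l c hl hc h
    have h1 := (Dl_anti (M := M) (d0 := d0) (β := β) hb0 hτ hl hc).trans h
    unfold Dl at h1
    have h2 := mul_le_mul_of_nonneg_left (add_one_le_exp (β * l ^ 2 - l * C * τ)) hb0.le
    have h3 := hM1 l
    have h4 : l * (b0 * β * l) ≤ l * (C + b0 * C * τ) := by nlinarith
    rw [hL, le_div_iff₀ (by positivity)]
    rcases hl.eq_or_lt with h0 | h0
    · rw [← h0]; simp; positivity
    · linarith [le_of_mul_le_mul_left h4 h0]
  have h00 : ∀ l, 0 ≤ l → 0 < Dl M b0 d0 τ β l 0 := by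
    intro l hl
    unfold Dl
    have h2 := hM1 l
    have h3 : 1 ≤ exp (β * l ^ 2 - l * 0 * τ) := by
      apply one_le_exp; simp; positivity
    nlinarith
  have hneg : ∀ l c, 0 ≤ l → c ≤ 0 → 0 < Dl M b0 d0 τ β l c := fun l c hl hc =>
    (h00 l hl).trans_le (Dl_anti hb0 hτ hl hc)
  have hz : ∀ c, 0 < Dl M b0 d0 τ β 0 c := by
    intro c; unfold Dl; have := hM1 0; simp; linarith
  have h1C : Dl M b0 d0 τ β 1 C ≤ 0 := by
    unfold Dl
    have : exp (β * 1 ^ 2 - 1 * C * τ) ≤ exp β := by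
      apply exp_le_exp.2; have : 0 ≤ C * τ := by positivity
      linarith
    nlinarith
  have hK : IsCompact ((Icc 0 L ×ˢ Icc 0 C) ∩ {p : ℝ × ℝ | Dl M b0 d0 τ β p.1 p.2 ≤ 0}) :=
    (isCompact_Icc.prod isCompact_Icc).inter_right (isClosed_le hcD continuous_const)
  obtain ⟨⟨ls, cs⟩, ⟨⟨hls, hcs⟩, hle⟩, hmin⟩ := hK.exists_isMinOn
    ⟨(1, C), ⟨⟨⟨zero_le_one, hbd 1 C zero_le_one le_rfl h1C⟩, ⟨hC0.le, le_rfl⟩⟩, h1C⟩⟩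
    (continuous_snd.continuousOn)
  simp only [mem_setOf_eq] at hle hls hcs
  have hlt : ∀ l, 0 ≤ l → ∀ c < cs, 0 < Dl M b0 d0 τ β l c := by
    intro l hl c hc
    by_contra hn
    push Not at hn
    have hc0 : 0 ≤ c := by
      by_contra h; exact absurd (hneg l c hl (by linarith)) (not_lt.2 hn)
    have hcC : c ≤ C := hc.le.trans hcs.2
    have : cs ≤ c := hmin (show (l, c) ∈ _ from ⟨⟨⟨hl, hbd l c hl hcC hn⟩, ⟨hc0, hcC⟩⟩, hn⟩)
    linarith
  have hge : ∀ l, 0 ≤ l → 0 ≤ Dl M b0 d0 τ β l cs := by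
    intro l hl
    have hc : Tendsto (fun c => Dl M b0 d0 τ β l c) (nhdsWithin cs (Iio cs)) (nhds (Dl M b0 d0 τ β l cs)) :=
      ((hcD.comp (by fun_prop : Continuous fun c : ℝ => (l, c))).tendsto cs).mono_left nhdsWithin_le_nhds
    exact ge_of_tendsto hc (by filter_upwards [self_mem_nhdsWithin] with c hc using (hlt l hl c hc).le)
  refine ⟨cs, ?_, ls, ?_, le_antisymm hle (hge ls hls.1), hlt, hge⟩
  · by_contra h; exact absurd (hneg ls cs hls.1 (by linarith)) (not_lt.2 hle)
  · rcases hls.1.eq_or_lt with h | h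
    · rw [← h] at hle; exact absurd (hz cs) (not_lt.2 hle)
    · exact h

lemma mk_NL {d b d' b' d'' b'' : ℝ → ℝ} {u : ℝ}
    (hu : 0 < u) (hd0 : d 0 = 0) (hb0 : b 0 = 0) (hdbu : d u = b u)
    (hd1 : ∀ x ∈ Icc 0 u, HasDerivAt d (d' x) x)
    (hb1 : ∀ x ∈ Icc 0 u, HasDerivAt b (b' x) x)
    (hd2 : ∀ x ∈ Icc 0 u, HasDerivAt d' (d'' x) x)
    (hb2 : ∀ x ∈ Icc 0 u, HasDerivAt b' (b'' x) x)
    (h2a : d' 0 < b' 0) (h2b : 0 ≤ d' 0) 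
    (h3 : ∀ x ∈ Icc 0 u, 0 ≤ d' x ∧ 0 ≤ b' x ∧ 0 ≤ d'' x ∧ b'' x ≤ 0) :
    NL d b u (d' u) (d' 0) (b' 0) (b u / u) := by
  have key : ∀ f f' : ℝ → ℝ, (∀ x ∈ Icc 0 u, HasDerivAt f (f' x) x) → (∀ x ∈ Icc 0 u, 0 ≤ f' x) →
      MonotoneOn f (Icc 0 u) := by
    intro f f' h h0
    refine monotoneOn_of_hasDerivWithinAt_nonneg (convex_Icc 0 u) (fun x hx => (h x hx).continuousAt.continuousWithinAt)
      (f' := f') ?_ ?_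
    · intro x hx; exact (h x (interior_subset hx)).hasDerivWithinAt
    · intro x hx; exact h0 x (interior_subset hx)
  have m0 : (0:ℝ) ∈ Icc 0 u := ⟨le_rfl, hu.le⟩
  have mu : u ∈ Icc 0 u := ⟨hu.le, le_rfl⟩
  have dm' := key d' d'' hd2 fun x hx => (h3 x hx).2.2.1
  have bm' : ∀ x ∈ Icc 0 u, ∀ y ∈ Icc 0 u, x ≤ y → b' y ≤ b' x := by
    intro x hx y hy hxy
    have := key (fun x => - b' x) (fun x => - b'' x) (fun x hx => (hb2 x hx).neg)
      (fun x hx => by have := (h3 x hx).2.2.2; linarith) hx hy hxy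
    simp only at this; linarith
  have dcv : ConvexOn ℝ (Icc 0 u) d := by
    refine MonotoneOn.convexOn_of_deriv (convex_Icc 0 u) (fun x hx => (hd1 x hx).continuousAt.continuousWithinAt)
      (fun x hx => (hd1 x (interior_subset hx)).differentiableAt.differentiableWithinAt) ?_
    intro x hx y hy hxy
    rw [(hd1 x (interior_subset hx)).deriv, (hd1 y (interior_subset hy)).deriv]
    exact dm' (interior_subset hx) (interior_subset hy) hxy
  have bcv : ConcaveOn ℝ (Icc 0 u) b := by
    refine AntitoneOn.concaveOn_of_deriv (convex_Icc 0 u) (fun x hx => (hb1 x hx).continuousAt.continuousWithinAt)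
      (fun x hx => (hb1 x (interior_subset hx)).differentiableAt.differentiableWithinAt) ?_
    intro x hx y hy hxy
    rw [(hb1 x (interior_subset hx)).deriv, (hb1 y (interior_subset hy)).deriv]
    exact bm' _ (interior_subset hx) _ (interior_subset hy) hxy
  have d0le : ∀ x ∈ Icc 0 u, d' 0 * x ≤ d x := by
    intro x hx
    have := key (fun x => d x - d' 0 * x) (fun x => d' x - d' 0 * 1)
      (fun x hx => (hd1 x hx).sub ((hasDerivAt_id x).const_mul _))
      (fun x hx => by have := dm' m0 hx hx.1; linarith) m0 hx hx.1
    simp only [hd0, mul_zero, sub_zero] at this; linarith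
  have b0le : ∀ x ∈ Icc 0 u, b x ≤ b' 0 * x := by
    intro x hx
    have := key (fun x => b' 0 * x - b x) (fun x => b' 0 * 1 - b' x)
      (fun x hx => ((hasDerivAt_id x).const_mul _).sub (hb1 x hx))
      (fun x hx => by have := bm' _ m0 _ hx hx.1; linarith) m0 hx hx.1
    simp only [hb0, mul_zero, sub_zero] at this; linarith
  have bm := key b b' hb1 fun x hx => (h3 x hx).2.1
  have dm := key d d' hd1 fun x hx => (h3 x hx).1
  -- positivity near zero
  have near : ∃ e, 0 < e ∧ ∀ x, 0 < x → x < e → d x < b x := by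
    have hh : HasDerivAt (fun x => b x - d x) (b' 0 - d' 0) 0 := (hb1 0 m0).sub (hd1 0 m0)
    have ht := hh.tendsto_slope_zero_right
    have he := ht.eventually (lt_mem_nhds (show 0 < b' 0 - d' 0 by linarith))
    rw [eventually_nhdsWithin_iff, Metric.eventually_nhds_iff] at he
    obtain ⟨e, he, h⟩ := he
    refine ⟨e, he, fun x hx hxe => ?_⟩
    have := h (by simpa [abs_of_pos hx] using hxe) hx
    simp only [zero_add, hb0, hd0, sub_zero, smul_eq_mul] at this
    have := (mul_pos_iff_of_pos_left (inv_pos.2 hx)).1 this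
    linarith
  have gcv : ConcaveOn ℝ (Icc 0 u) (fun x => b x - d x) := bcv.sub dcv
  have lt : ∀ x ∈ Ioo 0 u, d x < b x := by
    intro x hx
    obtain ⟨e, he, h⟩ := near
    set y := min (x / 2) (e / 2) with hy
    have hy0 : 0 < y := by have := hx.1; positivity
    have hyx : y < x := (min_le_left _ _).trans_lt (by have := hx.1; linarith)
    have hye : y < e := (min_le_right _ _).trans_lt (by linarith)
    have hg := h y hy0 hye
    have := gcv.slope_anti_adjacent (x := y) (y := x) (z := u) ⟨hy0.le, (hyx.trans hx.2).le⟩ mu hyx hx.2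
    simp only [hdbu, sub_self] at this
    by_contra hn
    push Not at hn
    have h1 : 0 ≤ (0 - (b x - d x)) / (u - x) := div_nonneg (by linarith) (by linarith [hx.2])
    have h2 : (b x - d x - (b y - d y)) / (x - y) < 0 := div_neg_of_neg_of_pos (by linarith) (by linarith)
    linarith
  have hbu : 0 < b u := by
    have hm2 : u / 2 ∈ Ioo 0 u := ⟨by linarith, by linarith⟩
    have h1 := lt _ hm2
    have h2 := dm m0 (Ioo_subset_Icc_self hm2) hm2.1.le
    have h3 := bm (Ioo_subset_Icc_self hm2) mu hm2.2.le
    rw [hd0] at h2; linarith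
  refine { hu := hu, dz := hd0, bz := hb0, du := hdbu, 
           dc := fun x hx => (hd1 x hx).continuousAt.continuousWithinAt
           bc := fun x hx => (hb1 x hx).continuousAt.continuousWithinAt
           bm := bm, dm := dm, Dm := ?_, hD := (h3 u mu).1, hd0 := h2b, hd0D := dm' m0 mu hu.le
           hb0 := by linarith, d0le := d0le, b0le := b0le, lt := lt, hκ := by positivity, κle := ?_
           hdd := hd1 0 m0, hbd := hb1 0 m0 }
  · exact key (fun x => d' u * x - d x) (fun x => d' u * 1 - d' x)
      (fun x hx => ((hasDerivAt_id x).const_mul _).sub (hd1 x hx))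
      (fun x hx => by have := dm' hx mu hx.2; linarith)
  · intro x hx
    have := bcv.2 m0 mu (show 0 ≤ 1 - x / u by rw [sub_nonneg, div_le_one hu]; exact hx.2)
      (div_nonneg hx.1 hu.le) (by ring)
    simp only [smul_eq_mul, hb0, mul_zero, zero_add] at this
    rw [div_mul_cancel₀ _ hu.ne'] at this
    calc b u / u * x = x / u * b u := by ring
      _ ≤ b x := this


lemma gauss_int {β : ℝ} (hβ : 0 < β) (g : ℝ → ℝ) :
    ∫ y, g y ∂(ProbabilityTheory.gaussianReal 0 (2 * β).toNNReal) = ∫ y, heatKernel1 β y * g y := by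
  have hv : (2 * β).toNNReal ≠ 0 := by simpa using hβ
  rw [ProbabilityTheory.integral_gaussianReal_eq_integral_smul hv]
  refine integral_congr_ae (ae_of_all _ fun y => ?_)
  show ProbabilityTheory.gaussianPDFReal 0 (2 * β).toNNReal y • g y = ((4 * Real.pi * β) ^ (-(1 : ℝ) / 2) * Real.exp (-y ^ 2 / (4 * β))) * g y
  rw [smul_eq_mul, ProbabilityTheory.gaussianPDFReal]
  have : ((2 * β).toNNReal : ℝ) = 2 * β := Real.coe_toNNReal _ (by linarith)
  rw [this, sqrt_eq_rpow, ← rpow_neg (by positivity)]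
  congr 2
  · congr 1 <;> ring
  · congr 1; ring

lemma gauss_exp {β : ℝ} (hβ : 0 < β) (l r : ℝ) :
    exp (-l * r) * ∫ y, exp (-l * y) ∂(ProbabilityTheory.gaussianReal 0 (2 * β).toNNReal) =
      exp (β * l ^ 2 - l * r) := by
  have h := congrFun (ProbabilityTheory.mgf_id_gaussianReal (μ := 0) (v := (2 * β).toNNReal)) (-l)
  simp only [ProbabilityTheory.mgf, id] at h
  rw [h, Real.coe_toNNReal _ (by linarith), ← exp_add]
  congr 1; ring

lemma gauss_Iic {β : ℝ} (hβ : 0 < β) (R : ℝ) :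
    0 < (ProbabilityTheory.gaussianReal 0 (2 * β).toNNReal).real (Iic R) := by
  have hv : (2 * β).toNNReal ≠ 0 := by simpa using hβ
  rw [measureReal_def, ENNReal.toReal_pos_iff]
  refine ⟨pos_iff_ne_zero.2 fun h => ?_, measure_lt_top _ _⟩
  have := ProbabilityTheory.gaussianReal_absolutelyContinuous' 0 hv h
  simp at this

/-- one-dimensional kernel facts -/
lemma kern {j : ℝ → ℝ} (hc : Continuous j) (he : ∀ y, j (-y) = j y) (hp : ∀ y, 0 ≤ j y)
    (h1 : ∫ y, j y = 1) (hx : ∀ l > (0:ℝ), Integrable (fun y => j y * exp (-l * y))) :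
    (∀ l : ℝ, Integrable (fun y => j y * exp (l * y))) ∧ 
    (∀ l : ℝ, 1 ≤ ∫ y, j y * exp (-l * y)) := by
  have hj : Integrable j := by
    by_contra h; rw [integral_undef h] at h1; norm_num at h1
  have hI : ∀ l : ℝ, Integrable (fun y => j y * exp (l * y)) := by
    intro l
    rcases lt_trichotomy l 0 with h | h | h
    · simpa using hx (-l) (by linarith)
    · subst h; simpa using hj
    · have := (hx l h).comp_neg
      refine this.congr (ae_of_all _ fun y => ?_)
      simp [he]
  refine ⟨hI, fun l => ?_⟩
  have e : ∫ y, j y * exp (-l * y) = ∫ y, j y * exp (l * y) := by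
    rw [← integral_neg_eq_self]
    refine integral_congr_ae (ae_of_all _ fun y => ?_)
    simp [he]
  have h2 : ∫ y, 2 * j y ≤ ∫ y, (j y * exp (-l * y) + j y * exp (l * y)) := by
    refine integral_mono (hj.const_mul 2) ((hI (-l)).add (hI l)) fun y => ?_
    show 2 * j y ≤ j y * exp (-l * y) + j y * exp (l * y)
    have h3 := add_one_le_exp (-l * y)
    have h4 := add_one_le_exp (l * y)
    have := hp y
    nlinarith
  rw [integral_const_mul, h1, integral_add (hI (-l)) (hI l), ← e] at h2
  linarith

/-- existence of the minimal wave speed and of monotone traveling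
wavefronts for `c ≥ c*`, nonexistence for `c < c*`. -/
theorem minimal_wave_speed {n : ℕ} [NeZero n]
    (d b d' b' d'' b'' : ℝ → ℝ) (uplus : ℝ)
    -- (H1)
    (huplus : 0 < uplus) (hd0 : d 0 = 0) (hb0 : b 0 = 0) (hdbu : d uplus = b uplus)
    (hd'def : ∀ u ∈ Set.Icc 0 uplus, HasDerivAt d (d' u) u)
    (hb'def : ∀ u ∈ Set.Icc 0 uplus, HasDerivAt b (b' u) u)
    (hd''def : ∀ u ∈ Set.Icc 0 uplus, HasDerivAt d' (d'' u) u)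
    (hb''def : ∀ u ∈ Set.Icc 0 uplus, HasDerivAt b' (b'' u) u)
    (hd''cont : ContinuousOn d'' (Set.Icc 0 uplus))
    (hb''cont : ContinuousOn b'' (Set.Icc 0 uplus))
    -- (H2)
    (h2a : d' 0 < b' 0) (h2b : 0 ≤ d' 0) (h2c : 0 ≤ b' uplus) (h2d : b' uplus < d' uplus)
    -- (H3)
    (h3 : ∀ u ∈ Set.Icc 0 uplus, 0 ≤ d' u ∧ 0 ≤ b' u ∧ 0 ≤ d'' u ∧ b'' u ≤ 0)
    -- (J1): J is a product of smooth, even, nonnegative, unit-mass 1-D kernels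
    (J₁ : Fin n → ℝ → ℝ) (J : Rn n → ℝ)
    (hJprod : ∀ x : Rn n, J x = ∏ i, J₁ i (x i))
    (hJsmooth : ∀ i, ContDiff ℝ (⊤ : ℕ∞) (J₁ i))
    (hJeven : ∀ i, ∀ y : ℝ, J₁ i (-y) = J₁ i y)
    (hJpos : ∀ i, ∀ y : ℝ, 0 ≤ J₁ i y)
    (hJunit : ∀ i, (∫ y : ℝ, J₁ i y) = 1)
    -- (J2): Ĵ(ξ) = 1 - 𝒦|ξ|^α + o(|ξ|^α) as ξ → 0
    (Kcal alpha : ℝ) (hK : 0 < Kcal) (hal : 0 < alpha) (hal2 : alpha ≤ 2)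
    (hJ2 : (fun ξ : Rn n => (FT J ξ).re - (1 - Kcal * ‖ξ‖ ^ alpha))
        =o[nhds 0] fun ξ : Rn n => ‖ξ‖ ^ alpha)
    (hJ1exp : ∀ lam > (0 : ℝ), Integrable (fun y : ℝ => J₁ 0 y * Real.exp (-lam * y)))
    (τ β : ℝ) (hτ : 0 ≤ τ) (hβ : 0 < β) :
    ∃ cstar > (0 : ℝ), ∃ lamstar > (0 : ℝ),
      -- tangency conditions H_{c*}(λ*) = G_{c*}(λ*), H'_{c*}(λ*) = G'_{c*}(λ*)
      (b' 0 * Real.exp (β * lamstar ^ 2 - lamstar * cstar * τ)) = (cstar * lamstar - ((∫ y : ℝ, J₁ 0 y * Real.exp (-lamstar * y)) - 1) + d' 0) ∧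
      (∃ slope : ℝ,
        HasDerivAt (fun lam => b' 0 * Real.exp (β * lam ^ 2 - lam * cstar * τ)) slope lamstar ∧
        HasDerivAt (fun lam =>
          cstar * lam - ((∫ y : ℝ, J₁ 0 y * Real.exp (-lam * y)) - 1) + d' 0) slope lamstar) ∧
      (∀ c ≥ cstar, (∃ phi phid : ℝ → ℝ, Monotone phi ∧
        (∀ ξ : ℝ, HasDerivAt phi (phid ξ) ξ) ∧ Continuous phid ∧
        Filter.Tendsto phi Filter.atBot (nhds 0) ∧
        Filter.Tendsto phi Filter.atTop (nhds uplus) ∧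
        ∀ ξ : ℝ, c * phid ξ - (∫ y : ℝ, J₁ 0 (ξ - y) * phi y) + phi ξ + d (phi ξ)
          = ∫ y : ℝ, heatKernel1 β y * b (phi (ξ - y - c * τ)))) ∧
      (∀ c < cstar, ¬ (∃ phi phid : ℝ → ℝ, Monotone phi ∧
        (∀ ξ : ℝ, HasDerivAt phi (phid ξ) ξ) ∧ Continuous phid ∧
        Filter.Tendsto phi Filter.atBot (nhds 0) ∧
        Filter.Tendsto phi Filter.atTop (nhds uplus) ∧
        ∀ ξ : ℝ, c * phid ξ - (∫ y : ℝ, J₁ 0 (ξ - y) * phi y) + phi ξ + d (phi ξ)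
          = ∫ y : ℝ, heatKernel1 β y * b (phi (ξ - y - c * τ)))) := by
  have H := mk_NL huplus hd0 hb0 hdbu hd'def hb'def hd''def hb''def h2a h2b h3
  set j := J₁ 0 with hj
  have hjc : Continuous j := (hJsmooth 0).continuous
  have hj0 : ∀ᵐ x ∂(volume : Measure ℝ), 0 ≤ j x := ae_of_all _ (hJpos 0)
  have hji : Integrable j := by
    by_contra h
    have := hJunit 0
    rw [integral_undef h] at this; norm_num at this
  obtain ⟨hI, hM1⟩ := kern hjc (hJeven 0) (hJpos 0) (hJunit 0) hJ1exp
  set ν : Measure ℝ := volume.withDensity fun x => ENNReal.ofReal (j x) with hν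
  have hpν : IsProbabilityMeasure ν := wd_prob hji hj0 (hJunit 0)
  have hνi : ∀ l, Integrable (fun y => exp (l * y)) ν := fun l =>
    (wd_integrable hjc.measurable hj0 _).2 (hI l)
  have hνe : ∀ g : ℝ → ℝ, ∫ y, g y ∂ν = ∫ y, j y * g y := fun g => wd_int hjc.measurable hj0 g
  set γ := ProbabilityTheory.gaussianReal 0 (2 * β).toNNReal with hγ
  have hγi : ∀ l, Integrable (fun y => exp (l * y)) γ := fun l =>
    ProbabilityTheory.integrable_exp_mul_gaussianReal l
  set M : ℝ → ℝ := fun l => ∫ y, j y * exp (-l * y) with hM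
  have hMm : M = fun l => ProbabilityTheory.mgf id ν (-l) := by
    funext l
    simp only [hM, ProbabilityTheory.mgf, id]
    rw [hνe]
  have hMd : Differentiable ℝ M := by
    intro l
    rw [hMm]
    have hset : ProbabilityTheory.integrableExpSet id ν = univ := by
      ext t; simpa [ProbabilityTheory.integrableExpSet] using hνi t
    have := ProbabilityTheory.hasDerivAt_mgf (X := id) (μ := ν) (t := -l) (by rw [hset]; simp)
    exact this.differentiableAt.comp l differentiableAt_id.neg
  obtain ⟨cs, hcs, ls, hls, hzero, hlt, hge⟩ :=
    crit (b0 := b' 0) (d0 := d' 0) hMd.continuous hM1 h2b h2a hτ hβ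
  have hDl : ∀ l c, b' 0 * (exp (-l * (c * τ)) * ∫ y, exp (-l * y) ∂γ) + (∫ y, exp (-l * y) ∂ν) - 1 - c * l - d' 0
      = Dl M (b' 0) (d' 0) τ β l c := by
    intro l c
    rw [gauss_exp hβ, hνe, Dl, mul_assoc l c τ]
  have hcv1 : ∀ (phi : ℝ → ℝ) x, ∫ y, j (x - y) * phi y = cv ν phi x := by
    intro phi x
    rw [cv, hνe, ← integral_sub_left_eq_self _ volume x]
    refine integral_congr_ae (ae_of_all _ fun y => ?_)
    simp
  have hcv2 : ∀ (phi : ℝ → ℝ) c x, ∫ y, heatKernel1 β y * b (phi (x - y - c * τ))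
      = cv γ (fun z => b (phi z)) (x - c * τ) := by
    intro phi c x
    rw [cv, gauss_int hβ]
    refine integral_congr_ae (ae_of_all _ fun y => ?_)
    show heatKernel1 β y * b (phi (x - y - c * τ)) = heatKernel1 β y * b (phi (x - c * τ - y))
    rw [sub_right_comm]
  refine ⟨cs, hcs, ls, hls, ?_, ?_, ?_, ?_⟩
  · unfold Dl at hzero
    show _ = cs * ls - (M ls - 1) + d' 0
    linarith
  · have hH : HasDerivAt (fun lam => b' 0 * Real.exp (β * lam ^ 2 - lam * cs * τ))
        (deriv (fun lam => b' 0 * Real.exp (β * lam ^ 2 - lam * cs * τ)) ls) ls := by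
      apply DifferentiableAt.hasDerivAt; fun_prop
    have hG : HasDerivAt (fun lam => cs * lam - (M lam - 1) + d' 0)
        (deriv (fun lam => cs * lam - (M lam - 1) + d' 0) ls) ls := by
      apply DifferentiableAt.hasDerivAt; fun_prop
    refine ⟨_, hH, ?_⟩
    have hloc : IsLocalMin (fun lam => b' 0 * Real.exp (β * lam ^ 2 - lam * cs * τ) -
        (cs * lam - (M lam - 1) + d' 0)) ls := by
      filter_upwards [Ioi_mem_nhds hls] with l hl
      have h1 := hge l (le_of_lt hl)
      unfold Dl at h1 hzero
      linarith
    have := hloc.hasDerivAt_eq_zero (hH.sub hG)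
    rw [sub_eq_zero.1 this]
    exact hG
  · intro c hc
    have h1 : Dl M (b' 0) (d' 0) τ β ls c ≤ 0 :=
      (Dl_anti (lt_of_le_of_lt h2b h2a) hτ hls.le hc).trans hzero.le
    rw [← hDl] at h1
    obtain ⟨phi, phid, a1, a2, a3, a4, a5, a6⟩ := H.exists_wave ν γ (c * τ) c ls (by linarith) hls
      (hνi (-ls)) (hγi (-ls)) h1
    refine ⟨phi, phid, a1, a2, a3, a4, a5, fun x => ?_⟩
    rw [hcv1, hcv2]; exact a6 x
  · rintro c hc ⟨phi, phid, a1, a2, a3, a4, a5, a6⟩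
    obtain ⟨l, hl, h⟩ := H.no_wave ν γ (c * τ) c hνi hγi (gauss_Iic hβ) a1 a2 a4 a5
      (fun x => by rw [← hcv1, ← hcv2]; exact a6 x)
    rw [hDl] at h
    exact absurd (hlt l hl c hc) (not_lt.2 h)

end
end

section
/- Assume (H1)-(H3) and (J1)-(J2), let τ≥0, β>0, suppose ∫_ℝ J₁(y)e^{−λy}dy<∞ for all λ>0, and let (c*,λ*) with c*>0, λ*>0 be the tangency point: H_{c*}(λ*)=G_{c*}(λ*) and H'_{c*}(λ*)=G'_{c*}(λ*). Then: (i) for every c>c* there exist λ₁=λ₁(c)>0 and λ₂=λ₂(c)>0 with λ₁<λ*<λ₂ such that H_c(λᵢ)=G_c(λᵢ) for i=1,2 and H_c(λ)<G_c(λ) for all λ∈(λ₁,λ₂); in particular H_c(λ*)<G_c(λ*); (ii) for c=c*, H_{c*}(λ*)=G_{c*}(λ*) and λ* is the unique positive root of H_{c*}(λ)=G_{c*}(λ). -/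
open MeasureTheory Real Set Filter Asymptotics

noncomputable section

theorem aux_M_convex (f : ℝ → ℝ) (hpos : ∀ y, 0 ≤ f y)
    (hint : ∀ l : ℝ, Integrable (fun y : ℝ => f y * Real.exp (-l * y))) :
    ConvexOn ℝ Set.univ (fun l : ℝ => ∫ y : ℝ, f y * Real.exp (-l * y)) := by
  refine ⟨convex_univ, ?_⟩
  intro x _ z _ a b ha hb hab
  simp only [smul_eq_mul]
  rw [← integral_const_mul, ← integral_const_mul,
    ← integral_add ((hint x).const_mul a) ((hint z).const_mul b)]
  refine integral_mono (hint _) (((hint x).const_mul a).add ((hint z).const_mul b)) ?_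
  intro y
  have h := convexOn_exp.2 (Set.mem_univ (-x * y)) (Set.mem_univ (-z * y)) ha hb hab
  simp only [smul_eq_mul] at h
  have e : -(a * x + b * z) * y = a * (-x * y) + b * (-z * y) := by ring
  have h2 := mul_le_mul_of_nonneg_left h (hpos y)
  simp only [e]
  linarith

theorem aux_H_convex (b0 β k : ℝ) (hb : 0 < b0) (hβ : 0 < β) :
    StrictConvexOn ℝ Set.univ (fun l : ℝ => b0 * Real.exp (β * l ^ 2 - l * k)) := by
  refine ⟨convex_univ, ?_⟩
  intro x _ z _ hxz s t hs ht hst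
  simp only [smul_eq_mul]
  have h := convexOn_exp.2 (Set.mem_univ (β * x ^ 2 - x * k))
    (Set.mem_univ (β * z ^ 2 - z * k)) hs.le ht.le hst
  simp only [smul_eq_mul] at h
  have e : β * (s * x + t * z) ^ 2 - (s * x + t * z) * k
      < s * (β * x ^ 2 - x * k) + t * (β * z ^ 2 - z * k) := by
    have h1 : 0 < (x - z) ^ 2 := by have := sub_ne_zero.2 hxz; positivity
    have h2 : 0 < β * (s * t * (x - z) ^ 2) := by positivity
    have h3 : t = 1 - s := by linarith
    subst h3
    nlinarith
  have h2 := mul_lt_mul_of_pos_left ((Real.exp_lt_exp.2 e).trans_le h) hb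
  linarith

theorem aux_F (b0 d0 τ β : ℝ) (M : ℝ → ℝ) (hM : ConvexOn ℝ Set.univ M)
    (hb : 0 < b0) (hβ : 0 < β) (c : ℝ) :
    StrictConvexOn ℝ Set.univ (fun l : ℝ => b0 * Real.exp (β * l ^ 2 - l * c * τ)
      - (c * l - (M l - 1) + d0)) := by
  have h1 := (aux_H_convex b0 β (c * τ) hb hβ).add_convexOn hM
  refine ⟨convex_univ, ?_⟩
  intro x hx z hz hxz s t hs ht hst
  have h := h1.2 hx hz hxz hs ht hst
  simp only [smul_eq_mul, Pi.add_apply, ← mul_assoc] at h ⊢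
  have h3 : t = 1 - s := by linarith
  subst h3
  nlinarith

theorem aux_main (b0 d0 τ β cs ls : ℝ) (M : ℝ → ℝ) (hM : ConvexOn ℝ Set.univ M)
    (hM0 : M 0 = 1) (hMn : ∀ l, 0 ≤ M l) (hd : 0 ≤ d0) (hdb : d0 < b0) (hβ : 0 < β)
    (hτ : 0 ≤ τ) (hcs : 0 < cs) (hls : 0 < ls)
    (htan : b0 * Real.exp (β * ls ^ 2 - ls * cs * τ) = cs * ls - (M ls - 1) + d0)
    (htan' : ∃ slope : ℝ,
      HasDerivAt (fun l => b0 * Real.exp (β * l ^ 2 - l * cs * τ)) slope ls ∧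
      HasDerivAt (fun l => cs * l - (M l - 1) + d0) slope ls) :
    (∀ c > cs, ∃ l₁ l₂ : ℝ, 0 < l₁ ∧ l₁ < ls ∧ ls < l₂ ∧
      b0 * Real.exp (β * l₁ ^ 2 - l₁ * c * τ) = c * l₁ - (M l₁ - 1) + d0 ∧
      b0 * Real.exp (β * l₂ ^ 2 - l₂ * c * τ) = c * l₂ - (M l₂ - 1) + d0 ∧
      (∀ l : ℝ, l₁ < l → l < l₂ →
        b0 * Real.exp (β * l ^ 2 - l * c * τ) < c * l - (M l - 1) + d0) ∧
      b0 * Real.exp (β * ls ^ 2 - ls * c * τ) < c * ls - (M ls - 1) + d0) ∧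
    (b0 * Real.exp (β * ls ^ 2 - ls * cs * τ) = cs * ls - (M ls - 1) + d0 ∧
      ∀ l > (0 : ℝ), b0 * Real.exp (β * l ^ 2 - l * cs * τ) = cs * l - (M l - 1) + d0 →
        l = ls) := by
  have hb : 0 < b0 := hd.trans_lt hdb
  refine ⟨?_, htan, ?_⟩
  · intro c hc
    have hF := aux_F b0 d0 τ β M hM hb hβ c
    set F : ℝ → ℝ := fun l : ℝ => b0 * Real.exp (β * l ^ 2 - l * c * τ)
      - (c * l - (M l - 1) + d0) with hFdef
    have hcont : Continuous F := by
      rw [← continuousOn_univ]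
      exact hF.convexOn.continuousOn isOpen_univ
    have hF0 : 0 < F 0 := by
      simp only [hFdef, hM0]; simp; linarith
    have hc0 : 0 < c := hcs.trans hc
    have hFs : F ls < 0 := by
      have h1 : Real.exp (β * ls ^ 2 - ls * c * τ) ≤ Real.exp (β * ls ^ 2 - ls * cs * τ) := by
        apply Real.exp_le_exp.2
        have : 0 ≤ ls * (c - cs) * τ := by
          have := sub_pos.2 hc
          positivity
        nlinarith
      have h2 := mul_le_mul_of_nonneg_left h1 hb.le
      have h3 := mul_lt_mul_of_pos_right hc hls
      simp only [hFdef]; linarith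
    obtain ⟨L, hL, hFL⟩ : ∃ L, ls < L ∧ 0 < F L := by
      set K := b0 * c * τ + c + 1 + d0 with hK
      have hKp : 0 < K := by positivity
      refine ⟨ls + 1 + K / (β * b0), ?_, ?_⟩
      · have : 0 < K / (β * b0) := by positivity
        linarith
      · set L := ls + 1 + K / (β * b0) with hLd
        have hq : 0 < K / (β * b0) := by positivity
        have hL1 : 1 ≤ L := by linarith
        have hqL : K / (β * b0) ≤ L := by linarith
        rw [div_le_iff₀ (by positivity)] at hqL
        have h1 := mul_le_mul_of_nonneg_right hqL (zero_le_one.trans hL1)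
        have h2 := mul_le_mul_of_nonneg_left (Real.add_one_le_exp (β * L ^ 2 - L * c * τ)) hb.le
        have h3 : 1 + d0 ≤ (1 + d0) * L := le_mul_of_one_le_right (by linarith) hL1
        have h4 := hMn L
        simp only [hFdef]
        have h5 : K * L = b0 * c * τ * L + c * L + (1 + d0) * L := by rw [hK]; ring
        nlinarith
    obtain ⟨l₁, hl₁, e₁⟩ := intermediate_value_Ioo' hls.le hcont.continuousOn ⟨hFs, hF0⟩
    obtain ⟨l₂, hl₂, e₂⟩ := intermediate_value_Ioo hL.le hcont.continuousOn ⟨hFs, hFL⟩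
    refine ⟨l₁, l₂, hl₁.1, hl₁.2, hl₂.1, sub_eq_zero.1 e₁, sub_eq_zero.1 e₂, ?_, sub_neg.1 hFs⟩
    intro l h1 h2
    have := hF.lt_on_openSegment (Set.mem_univ l₁) (Set.mem_univ l₂) (h1.trans h2).ne
      (z := l) (by rw [openSegment_eq_Ioo (h1.trans h2)]; exact ⟨h1, h2⟩)
    rw [e₁, e₂, max_self] at this
    exact sub_neg.1 this
  · intro l _ hl
    have hF := aux_F b0 d0 τ β M hM hb hβ cs
    obtain ⟨m, hm1, hm2⟩ := htan'
    have hD := hm1.sub hm2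
    rw [sub_self] at hD
    have hD' : HasDerivAt (fun l : ℝ => b0 * Real.exp (β * l ^ 2 - l * cs * τ)
      - (cs * l - (M l - 1) + d0)) 0 ls := hD
    rcases lt_trichotomy l ls with h | h | h
    · have := hF.slope_lt_of_hasDerivAt (Set.mem_univ _) (Set.mem_univ _) h hD'
      simp [slope_def_field, htan, hl] at this
    · exact h
    · have := hF.lt_slope_of_hasDerivAt (Set.mem_univ _) (Set.mem_univ _) h hD'
      simp [slope_def_field, htan, hl] at this

/-- for `c > c*` the functions `H_c` and `G_c` have exactly two positive
intersection points `λ₁ < λ* < λ₂` with `H_c < G_c` strictly in between; for `c = c*`,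
`λ*` is the unique positive root of `H_{c*} = G_{c*}`. -/
theorem wave_speed_roots {n : ℕ} [NeZero n]
    (d b d' b' d'' b'' : ℝ → ℝ) (uplus : ℝ)
    -- (H1)
    (huplus : 0 < uplus) (hd0 : d 0 = 0) (hb0 : b 0 = 0) (hdbu : d uplus = b uplus)
    (hd'def : ∀ u ∈ Set.Icc 0 uplus, HasDerivAt d (d' u) u)
    (hb'def : ∀ u ∈ Set.Icc 0 uplus, HasDerivAt b (b' u) u)
    (hd''def : ∀ u ∈ Set.Icc 0 uplus, HasDerivAt d' (d'' u) u)
    (hb''def : ∀ u ∈ Set.Icc 0 uplus, HasDerivAt b' (b'' u) u)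
    (hd''cont : ContinuousOn d'' (Set.Icc 0 uplus))
    (hb''cont : ContinuousOn b'' (Set.Icc 0 uplus))
    -- (H2)
    (h2a : d' 0 < b' 0) (h2b : 0 ≤ d' 0) (h2c : 0 ≤ b' uplus) (h2d : b' uplus < d' uplus)
    -- (H3)
    (h3 : ∀ u ∈ Set.Icc 0 uplus, 0 ≤ d' u ∧ 0 ≤ b' u ∧ 0 ≤ d'' u ∧ b'' u ≤ 0)
    -- (J1): J is a product of smooth, even, nonnegative, unit-mass 1-D kernels
    (J₁ : Fin n → ℝ → ℝ) (J : Rn n → ℝ)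
    (hJprod : ∀ x : Rn n, J x = ∏ i, J₁ i (x i))
    (hJsmooth : ∀ i, ContDiff ℝ (⊤ : ℕ∞) (J₁ i))
    (hJeven : ∀ i, ∀ y : ℝ, J₁ i (-y) = J₁ i y)
    (hJpos : ∀ i, ∀ y : ℝ, 0 ≤ J₁ i y)
    (hJunit : ∀ i, (∫ y : ℝ, J₁ i y) = 1)
    -- (J2): Ĵ(ξ) = 1 - 𝒦|ξ|^α + o(|ξ|^α) as ξ → 0
    (Kcal alpha : ℝ) (hK : 0 < Kcal) (hal : 0 < alpha) (hal2 : alpha ≤ 2)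
    (hJ2 : (fun ξ : Rn n => (FT J ξ).re - (1 - Kcal * ‖ξ‖ ^ alpha))
        =o[nhds 0] fun ξ : Rn n => ‖ξ‖ ^ alpha)
    (hJ1exp : ∀ lam > (0 : ℝ), Integrable (fun y : ℝ => J₁ 0 y * Real.exp (-lam * y)))
    (τ β : ℝ) (hτ : 0 ≤ τ) (hβ : 0 < β)
    (cstar lamstar : ℝ) (hcstar : 0 < cstar) (hlamstar : 0 < lamstar)
    (htan : (b' 0 * Real.exp (β * lamstar ^ 2 - lamstar * cstar * τ)) = (cstar * lamstar - ((∫ y : ℝ, J₁ 0 y * Real.exp (-lamstar * y)) - 1) + d' 0))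
    (htan' : ∃ slope : ℝ,
      HasDerivAt (fun lam => b' 0 * Real.exp (β * lam ^ 2 - lam * cstar * τ)) slope lamstar ∧
      HasDerivAt (fun lam =>
        cstar * lam - ((∫ y : ℝ, J₁ 0 y * Real.exp (-lam * y)) - 1) + d' 0) slope lamstar)
 :
    (∀ c > cstar, ∃ lam₁ lam₂ : ℝ, 0 < lam₁ ∧ lam₁ < lamstar ∧ lamstar < lam₂ ∧
      (b' 0 * Real.exp (β * lam₁ ^ 2 - lam₁ * c * τ)) = (c * lam₁ - ((∫ y : ℝ, J₁ 0 y * Real.exp (-lam₁ * y)) - 1) + d' 0) ∧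
      (b' 0 * Real.exp (β * lam₂ ^ 2 - lam₂ * c * τ)) = (c * lam₂ - ((∫ y : ℝ, J₁ 0 y * Real.exp (-lam₂ * y)) - 1) + d' 0) ∧
      (∀ lam : ℝ, lam₁ < lam → lam < lam₂ →
        (b' 0 * Real.exp (β * lam ^ 2 - lam * c * τ)) < (c * lam - ((∫ y : ℝ, J₁ 0 y * Real.exp (-lam * y)) - 1) + d' 0)) ∧
      (b' 0 * Real.exp (β * lamstar ^ 2 - lamstar * c * τ)) < (c * lamstar - ((∫ y : ℝ, J₁ 0 y * Real.exp (-lamstar * y)) - 1) + d' 0)) ∧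
    ((b' 0 * Real.exp (β * lamstar ^ 2 - lamstar * cstar * τ)) = (cstar * lamstar - ((∫ y : ℝ, J₁ 0 y * Real.exp (-lamstar * y)) - 1) + d' 0) ∧
      ∀ lam > (0 : ℝ), (b' 0 * Real.exp (β * lam ^ 2 - lam * cstar * τ)) = (cstar * lam - ((∫ y : ℝ, J₁ 0 y * Real.exp (-lam * y)) - 1) + d' 0) →
        lam = lamstar) := by
  have hI0 : Integrable (J₁ 0) := by
    by_contra h
    have h1 := hJunit 0
    rw [integral_undef h] at h1
    exact zero_ne_one h1
  have hint : ∀ l : ℝ, Integrable (fun y : ℝ => J₁ 0 y * Real.exp (-l * y)) := by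
    intro l
    rcases lt_trichotomy l 0 with h | h | h
    · have h1 := (hJ1exp (-l) (by linarith)).comp_neg
      refine h1.congr (Filter.Eventually.of_forall fun y => ?_)
      simp [hJeven]
    · subst h
      simpa using hI0
    · exact hJ1exp l h
  exact aux_main (b' 0) (d' 0) τ β cstar lamstar
    (fun l => ∫ y : ℝ, J₁ 0 y * Real.exp (-l * y))
    (aux_M_convex _ (hJpos 0) hint) (by simpa using hJunit 0)
    (fun l => integral_nonneg fun y => mul_nonneg (hJpos 0 y) (Real.exp_pos _).le)
    h2b h2a hβ hτ hcstar hlamstar htan htan'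

end
end
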